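/- Let F = ℚ(√d) with d ≥ 6 squarefree, assume Nm_{F/ℚ}(ε) = 1, let H = (−1,−ε/F), and let 𝒪₂‡ = O_F + O_F·i + O_F·j + O_F·k. Whenever ε ∈ ℤ[√d] (which holds when d ≢ 1 (mod 4), and also when d ≡ 1 (mod 8)), write ε = a + b√d with positive integers a, b. Then the pair (ℵ(𝒪₂‡), ℶ(𝒪₂‡)) equals: (1,1) if d ≡ 1 (mod 8) and a ≡ 1 (mod 4); (4,2) if d ≡ 1 (mod 8) and a ≡ 3 (mod 4); (2,1) if d ≡ 5 (mod 8); (2,2) if d ≡ 3 (mod 4) and a is even; and (4,3) otherwise (i.e. if d ≡ 2 (mod 4), or if d ≡ 3 (mod 4) and a is odd). -/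

import Mathlib

open NumberField Quaternion

noncomputable section

namespace QuatPaper

variable (F : Type) [Field F] [NumberField F]

def scalarSet (H : Type) [Ring H] [Algebra F H] : Set H :=
  Set.range fun r : 𝓞 F => algebraMap F H (algebraMap (𝓞 F) F r)

def IsOrder {H : Type} [Ring H] [Algebra F H] (O : Subring H) : Prop :=
  scalarSet F H ⊆ ↑O ∧ O.toAddSubgroup.FG ∧ Submodule.span F (O : Set H) = ⊤

def IsMaximalOrder {H : Type} [Ring H] [Algebra F H] (O : Subring H) : Prop :=
  IsOrder F O ∧ ∀ O' : Subring H, IsOrder F O' → O ≤ O' → O' = O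

def IsScalarUnit {H : Type} [Ring H] [Algebra F H] {O : Subring H} (u : (↥O)ˣ) : Prop :=
  ∃ r : (𝓞 F)ˣ, ((u : ↥O) : H) = algebraMap F H (algebraMap (𝓞 F) F ↑r)

def RedUnitIso {H : Type} [Ring H] [Algebra F H] (O : Subring H) (G : Type*) [Group G] : Prop :=
  ∃ φ : (↥O)ˣ →* G, Function.Surjective φ ∧ ∀ u, φ u = 1 ↔ IsScalarUnit F u

def IsConjugate {H : Type} [Ring H] (x : Hˣ) (O O' : Subring H) : Prop :=
  ∀ y : H, y ∈ O ↔ (x : H) * y * ((x⁻¹ : Hˣ) : H) ∈ O'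

def ConjRel {H : Type} [Ring H] (O O' : Subring H) : Prop :=
  ∃ x : Hˣ, IsConjugate x O O'

def typeNum (H : Type) [Ring H] [Algebra F H] (G : Type*) [Group G] : ℕ :=
  Nat.card (Quot fun O O' : {O : Subring H // IsMaximalOrder F O ∧ RedUnitIso F O G} =>
    ConjRel O.1 O'.1)

def IsQuatAlg (H : Type) [Ring H] [Algebra F H] : Prop :=
  ∃ a b : F, a ≠ 0 ∧ b ≠ 0 ∧ Nonempty (H ≃ₐ[F] ℍ[F, a, b])

def TotallyDefinite (H : Type) [Ring H] [Algebra F H] : Prop :=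
  ∀ σ : F →+* ℝ,
    letI : Algebra F ℝ := σ.toAlgebra
    ∀ x : TensorProduct F ℝ H, x ≠ 0 → IsUnit x

/-- The reduced norm `Nr(x) = x·x̄` of a quaternion `x ∈ ℍ[F, A, B]`. -/
def redNorm {A B : F} (x : ℍ[F, A, B]) : F := (x * star x).re

/-- The reduced unit group of `O` is isomorphic to the dihedral group `D_n` and is
of the *first kind*: every element of order `2` in `O^×/O_F^×` admits a representative
whose reduced norm is the square of a unit of `O_F`. -/
def RedUnitDihedralFirstKind {A B : F} (n : ℕ) (O : Subring ℍ[F, A, B]) : Prop :=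
  ∃ φ : (↥O)ˣ →* DihedralGroup n, Function.Surjective φ ∧
    (∀ u, φ u = 1 ↔ IsScalarUnit F u) ∧
    ∀ u : (↥O)ˣ, φ u ≠ 1 → φ u * φ u = 1 →
      ∃ u' : (↥O)ˣ, φ u' = φ u ∧ ∃ r : (𝓞 F)ˣ,
        redNorm F ((u' : ↥O) : ℍ[F, A, B]) = algebraMap (𝓞 F) F ↑r ^ 2

/-- The reduced unit group of `O` is isomorphic to the dihedral group `D_n` and is
of the *second kind*: some element of order `2` in `O^×/O_F^×` has no representative
whose reduced norm is the square of a unit of `O_F`. -/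
def RedUnitDihedralSecondKind {A B : F} (n : ℕ) (O : Subring ℍ[F, A, B]) : Prop :=
  ∃ φ : (↥O)ˣ →* DihedralGroup n, Function.Surjective φ ∧
    (∀ u, φ u = 1 ↔ IsScalarUnit F u) ∧
    ∃ u : (↥O)ˣ, φ u ≠ 1 ∧ φ u * φ u = 1 ∧
      ∀ u' : (↥O)ˣ, φ u' = φ u → ∀ r : (𝓞 F)ˣ,
        redNorm F ((u' : ↥O) : ℍ[F, A, B]) ≠ algebraMap (𝓞 F) F ↑r ^ 2

/-- `t(H, D_n†)`: the number of conjugacy classes of maximal orders whose reduced unit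
group is isomorphic to `D_n` of the first kind. -/
def typeNumDnFirstKind (A B : F) (n : ℕ) : ℕ :=
  Nat.card (Quot fun O O' : {O : Subring ℍ[F, A, B] //
      IsMaximalOrder F O ∧ RedUnitDihedralFirstKind F n O} => ConjRel O.1 O'.1)

/-- `t(H, D_n‡)`: the number of conjugacy classes of maximal orders whose reduced unit
group is isomorphic to `D_n` of the second kind. -/
def typeNumDnSecondKind (A B : F) (n : ℕ) : ℕ :=
  Nat.card (Quot fun O O' : {O : Subring ℍ[F, A, B] //
      IsMaximalOrder F O ∧ RedUnitDihedralSecondKind F n O} => ConjRel O.1 O'.1)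

/-- `ℵ(O₀)`: the number of maximal orders containing `O₀`. -/
def alephNum {H : Type} [Ring H] [Algebra F H] (O₀ : Subring H) : ℕ :=
  Nat.card {O : Subring H // IsMaximalOrder F O ∧ O₀ ≤ O}

/-- `ℶ(O₀)`: the number of orbits of the conjugation action of the normalizer
`N(O₀)` on the set of maximal orders containing `O₀`. -/
def bethNum {H : Type} [Ring H] [Algebra F H] (O₀ : Subring H) : ℕ :=
  Nat.card (Quot fun O O' : {O : Subring H // IsMaximalOrder F O ∧ O₀ ≤ O} =>
    ∃ x : Hˣ, IsConjugate x O₀ O₀ ∧ IsConjugate x O.1 O'.1)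

section HalfIntegralLattices

variable {R : Type*} [CommRing R]

/-- The norm form of `ℍ[R, -1, -e]`. -/
def quatNorm {e : R} (x : ℍ[R, -1, -e]) : R :=
  x.re ^ 2 + x.imI ^ 2 + e * (x.imJ ^ 2 + x.imK ^ 2)

/-- Conjugation by `1 + i` in coordinates: `i ↦ i`, `j ↦ k`, `k ↦ -j`. -/
def rotate {e : R} (x : ℍ[R, -1, -e]) : ℍ[R, -1, -e] :=
  ⟨x.re, x.imI, -x.imK, x.imJ⟩

/-- A lattice `L` for which `½ L` is a ring containing `ℍ[R, -1, -e]`. -/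
structure IsHalfOrder {e : R} (L : AddSubgroup ℍ[R, -1, -e]) : Prop where
  two_mem : ∀ x, x + x ∈ L
  mul_mem : ∀ x ∈ L, ∀ y ∈ L, ∃ z ∈ L, z + z = x * y

variable (e : R)

/-- The doubled form of the order whose residues modulo `2` satisfy
`a + b = s (c + d)` and `a + s c = ν (c + d)`. -/
def lineLattice (s ν : R) : AddSubgroup ℍ[R, -1, -e] where
  carrier := {x | 2 ∣ x.re + x.imI + s * (x.imJ + x.imK) ∧
    2 ∣ x.re + s * x.imJ + ν * (x.imJ + x.imK)}
  zero_mem' := by simp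
  add_mem' := by
    rintro x y ⟨⟨a, ha⟩, ⟨b, hb⟩⟩ ⟨⟨c, hc⟩, ⟨d, hd⟩⟩
    exact ⟨⟨a + c, by simp; linear_combination ha + hc⟩,
      ⟨b + d, by simp; linear_combination hb + hd⟩⟩
  neg_mem' := by
    rintro x ⟨⟨a, ha⟩, ⟨b, hb⟩⟩
    exact ⟨⟨-a, by simp; linear_combination -ha⟩, ⟨-b, by simp; linear_combination -hb⟩⟩

/-- The doubled form of the order whose residues modulo `2` satisfy `b = g a` and `d = g c`. -/
def splitLattice (g : R) : AddSubgroup ℍ[R, -1, -e] where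
  carrier := {x | 2 ∣ x.imI - g * x.re ∧ 2 ∣ x.imK - g * x.imJ}
  zero_mem' := by simp
  add_mem' := by
    rintro x y ⟨⟨a, ha⟩, ⟨b, hb⟩⟩ ⟨⟨c, hc⟩, ⟨d, hd⟩⟩
    exact ⟨⟨a + c, by simp; linear_combination ha + hc⟩,
      ⟨b + d, by simp; linear_combination hb + hd⟩⟩
  neg_mem' := by
    rintro x ⟨⟨a, ha⟩, ⟨b, hb⟩⟩
    exact ⟨⟨-a, by simp; linear_combination -ha⟩, ⟨-b, by simp; linear_combination -hb⟩⟩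

/-- The doubled form of the order whose residues modulo `2` satisfy
`a + b = p c` and `c + d = p a`. -/
def crossLattice (p : R) : AddSubgroup ℍ[R, -1, -e] where
  carrier := {x | 2 ∣ x.re + x.imI - p * x.imJ ∧ 2 ∣ x.imJ + x.imK - p * x.re}
  zero_mem' := by simp
  add_mem' := by
    rintro x y ⟨⟨a, ha⟩, ⟨b, hb⟩⟩ ⟨⟨c, hc⟩, ⟨d, hd⟩⟩
    exact ⟨⟨a + c, by simp; linear_combination ha + hc⟩,
      ⟨b + d, by simp; linear_combination hb + hd⟩⟩
  neg_mem' := by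
    rintro x ⟨⟨a, ha⟩, ⟨b, hb⟩⟩
    exact ⟨⟨-a, by simp; linear_combination -ha⟩, ⟨-b, by simp; linear_combination -hb⟩⟩

/-- The doubled form of the order whose residues modulo `2` lie in the span of
`(1, 1, 1, 1)`, `(0, p, 0, p)` and `(0, 0, p, p)`; for `p = 0` it is the Hurwitz order. -/
def hurwitzLattice (p : R) : AddSubgroup ℍ[R, -1, -e] where
  carrier := {x | ∃ β γ, 2 ∣ x.imI - x.re - p * β ∧ 2 ∣ x.imJ - x.re - p * γ ∧
    2 ∣ x.imK - x.re - p * β - p * γ}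
  zero_mem' := ⟨0, 0, by simp⟩
  add_mem' := by
    rintro x y ⟨β, γ, ⟨a, ha⟩, ⟨b, hb⟩, ⟨c, hc⟩⟩ ⟨β', γ', ⟨a', ha'⟩, ⟨b', hb'⟩, ⟨c', hc'⟩⟩
    exact ⟨β + β', γ + γ', ⟨a + a', by simp; linear_combination ha + ha'⟩,
      ⟨b + b', by simp; linear_combination hb + hb'⟩,
      ⟨c + c', by simp; linear_combination hc + hc'⟩⟩
  neg_mem' := by
    rintro x ⟨β, γ, ⟨a, ha⟩, ⟨b, hb⟩, ⟨c, hc⟩⟩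
    exact ⟨-β, -γ, ⟨-a, by simp; linear_combination -ha⟩,
      ⟨-b, by simp; linear_combination -hb⟩, ⟨-c, by simp; linear_combination -hc⟩⟩

variable {e}

lemma mem_lineLattice {s ν : R} {x : ℍ[R, -1, -e]} : x ∈ lineLattice e s ν ↔
    2 ∣ x.re + x.imI + s * (x.imJ + x.imK) ∧ 2 ∣ x.re + s * x.imJ + ν * (x.imJ + x.imK) :=
  Iff.rfl

lemma mem_splitLattice {g : R} {x : ℍ[R, -1, -e]} : x ∈ splitLattice e g ↔
    2 ∣ x.imI - g * x.re ∧ 2 ∣ x.imK - g * x.imJ :=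
  Iff.rfl

lemma mem_crossLattice {p : R} {x : ℍ[R, -1, -e]} : x ∈ crossLattice e p ↔
    2 ∣ x.re + x.imI - p * x.imJ ∧ 2 ∣ x.imJ + x.imK - p * x.re :=
  Iff.rfl

/-- To check multiplicativity of a half-order it is enough to halve the coordinates of a
product. -/
lemma exists_half_mul {L : AddSubgroup ℍ[R, -1, -e]} {x y : ℍ[R, -1, -e]}
    (h : ∃ a b c d : R, (⟨a, b, c, d⟩ : ℍ[R, -1, -e]) ∈ L ∧
      2 * a = x.re * y.re - x.imI * y.imI - e * x.imJ * y.imJ - e * x.imK * y.imK ∧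
      2 * b = x.re * y.imI + x.imI * y.re + e * (x.imJ * y.imK - x.imK * y.imJ) ∧
      2 * c = x.re * y.imJ + x.imJ * y.re - x.imI * y.imK + x.imK * y.imI ∧
      2 * d = x.re * y.imK + x.imK * y.re + x.imI * y.imJ - x.imJ * y.imI) :
    ∃ z ∈ L, z + z = x * y := by
  obtain ⟨a, b, c, d, hL, ha, hb, hc, hd⟩ := h
  refine ⟨_, hL, ?_⟩
  ext
  · simp; linear_combination ha
  · simp; linear_combination hb
  · simp; linear_combination hc
  · simp; linear_combination hd

lemma lineLattice_mul {s ν z x y c d x' y' c' d' : R}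
    (he : e = 4 * z - 2 * ν ^ 2 - 2 * s * ν - s ^ 2) {a b a' b' : R}
    (ha : a = 2 * y - s * c - ν * (c + d)) (hb : b = 2 * x - a - s * (c + d))
    (ha' : a' = 2 * y' - s * c' - ν * (c' + d')) (hb' : b' = 2 * x' - a' - s * (c' + d')) :
    ∃ A B C D : R, (⟨A, B, C, D⟩ : ℍ[R, -1, -e]) ∈ lineLattice e s ν ∧
      2 * A = a * a' - b * b' - e * c * c' - e * d * d' ∧
      2 * B = a * b' + b * a' + e * (c * d' - d * c') ∧
      2 * C = a * c' + c * a' - b * d' + d * b' ∧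
      2 * D = a * d' + d * a' + b * c' - c * b' := by
  subst hb hb' ha ha' he
  refine ⟨-c'*s*y - c*s*y' + c*c'*s^2 + 2*c*c'*s*ν + c*d'*s*ν + c'*d*s*ν - 2*x*x' + 2*x*y' - c'*x*ν -
    d'*x*ν + d'*s*x + 2*x'*y - d'*s*y - c*x'*ν - d*x'*ν + 2*d*d'*s*ν + d*s*x' - d*s*y' - 2*c*c'*z +
    c*c'*ν^2 - 2*d*d'*z + d*d'*ν^2,
    2*x'*y - 4*y*y' + 2*c'*y*ν + 2*d'*y*ν - d'*s*y - c*s*x' + c*s*y' - c*c'*s*ν - c*x'*ν + 2*c*y'*ν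
    - c*c'*ν^2 - 2*c*d'*ν^2 - d*x'*ν + 2*d*y'*ν - d*d'*ν^2 + d*d'*s*ν + 2*x*y' - c'*s*x - c'*x*ν -
    d'*x*ν + c'*s*y - d*s*y' + c'*d*s^2 + 2*c*d'*z - 2*c'*d*z - c*d'*s*ν + c'*d*s*ν,
    c'*y - c*c'*s - c*c'*ν + c*y' - c*d'*ν - d'*x + d'*y + d*x' - d*y',
    d'*y - c*d'*ν - d*d'*ν + d*y' - c'*d*s + c'*x - c'*y - c*x' + c*y', ?_,
    by ring,
    by ring,
    by ring,
    by ring⟩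
  exact ⟨⟨c'*d*s*ν - x*x' + 2*x*y' - c'*x*ν - d'*x*ν + 2*x'*y - c*x'*ν - d*x'*ν + d*d'*s*ν + d*s*x' -
    d*s*y' - c*c'*z - d*d'*z - 2*y*y' + c'*y*ν + d'*y*ν - c*s*x' + c*y'*ν - c*d'*ν^2 + d*y'*ν +
    c*d'*z - c'*d*z + c*s*y' - c*d'*s*ν,
    by ring⟩,
    ⟨-x*x' + x*y' - d'*x*ν + x'*y - c*x'*ν + d*d'*s*ν + d*s*x' - d*s*y' - c*c'*z - d*d'*z + c*y'*ν -
    c*d'*ν^2 + d'*y*ν,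
    by ring⟩⟩

lemma isHalfOrder_lineLattice {s ν : R} (h : 4 ∣ e + s ^ 2 + 2 * s * ν + 2 * ν ^ 2) :
    IsHalfOrder (lineLattice e s ν) where
  two_mem x := ⟨⟨x.re + x.imI + s * (x.imJ + x.imK), by simp; ring⟩,
    ⟨x.re + s * x.imJ + ν * (x.imJ + x.imK), by simp; ring⟩⟩
  mul_mem := by
    rintro X ⟨⟨x, hx⟩, ⟨y, hy⟩⟩ Y ⟨⟨x', hx'⟩, ⟨y', hy'⟩⟩
    obtain ⟨z, hz⟩ := h
    exact exists_half_mul (lineLattice_mul (z := z) (x := x) (y := y) (x' := x') (y' := y')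
      (by linear_combination hz) (by linear_combination hy) (by linear_combination hx)
      (by linear_combination hy') (by linear_combination hx'))

lemma splitLattice_mul {g y a b c d a' b' c' d' : R} (hg : g ^ 2 = 4 * y - 1) {B D B' D' : R}
    (hB : B = g * a + 2 * b) (hD : D = g * c + 2 * d)
    (hB' : B' = g * a' + 2 * b') (hD' : D' = g * c' + 2 * d') :
    ∃ t u v w : R, (⟨t, u, v, w⟩ : ℍ[R, -1, -e]) ∈ splitLattice e g ∧
      2 * t = a * a' - B * B' - e * c * c' - e * D * D' ∧
      2 * u = a * B' + B * a' + e * (c * D' - D * c') ∧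
      2 * v = a * c' + c * a' - B * D' + D * B' ∧
      2 * w = a * D' + D * a' + B * c' - c * B' := by
  subst hB hD hB' hD'
  refine ⟨a*a' - a*b'*g - a'*b*g - 2*b*b' - c*d'*e*g - c'*d*e*g - 2*d*d'*e - 2*a*a'*y - 2*c*c'*e*y,
    a*a'*g + a*b' + a'*b + c*d'*e - c'*d*e,
    a*c' - a*d'*g - b*c'*g - 2*b*d' + b'*c*g + a'*d*g + 2*b'*d - 2*a*c'*y + 2*a'*c*y,
    a*c'*g + a*d' + a'*d + b*c' - b'*c, ?_,
    by linear_combination (a*a' + c*c'*e) * hg,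
    by ring,
    by linear_combination (a*c' - a'*c) * hg,
    by ring⟩
  exact ⟨⟨-c'*d*e + b*b'*g + d*d'*e*g + a*a'*g*y + c*c'*e*g*y + 2*a*b'*y + 2*a'*b*y + 2*c*d'*e*y +
    2*c'*d*e*y,
    by linear_combination (a*b' + a'*b + c*d'*e + c'*d*e) * hg⟩,
    ⟨a'*d + b*d'*g - b'*d*g + a*c'*g*y - a'*c*g*y + 2*a*d'*y + 2*b*c'*y - 2*b'*c*y - 2*a'*d*y,
    by linear_combination (a*d' + b*c' - b'*c - a'*d) * hg⟩⟩

lemma isHalfOrder_splitLattice {g : R} (h : 4 ∣ g ^ 2 + 1) :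
    IsHalfOrder (splitLattice e g) where
  two_mem x := ⟨⟨x.imI - g * x.re, by simp; ring⟩, ⟨x.imK - g * x.imJ, by simp; ring⟩⟩
  mul_mem := by
    rintro X ⟨⟨x, hx⟩, ⟨y, hy⟩⟩ Y ⟨⟨x', hx'⟩, ⟨y', hy'⟩⟩
    obtain ⟨z, hz⟩ := h
    exact exists_half_mul (splitLattice_mul (y := z) (b := x) (d := y) (b' := x') (d' := y')
      (by linear_combination hz) (by linear_combination hx) (by linear_combination hy)
      (by linear_combination hx') (by linear_combination hy'))

lemma hurwitzLattice_mul {p w v a x y b c d a' x' y' b' c' d' : R}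
    (hp : p ^ 2 = 2 * w) (he : e = 2 * v - 1) {X Y Z X' Y' Z' : R}
    (hX : X = a + p * x + 2 * b) (hY : Y = a + p * y + 2 * c)
    (hZ : Z = a + p * x + p * y + 2 * d) (hX' : X' = a' + p * x' + 2 * b')
    (hY' : Y' = a' + p * y' + 2 * c') (hZ' : Z' = a' + p * x' + p * y' + 2 * d') :
    ∃ A B C D : R, (⟨A, B, C, D⟩ : ℍ[R, -1, -e]) ∈ hurwitzLattice e p ∧
      2 * A = a * a' - X * X' - e * Y * Y' - e * Z * Z' ∧
      2 * B = a * X' + X * a' + e * (Y * Z' - Z * Y') ∧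
      2 * C = a * Y' + Y * a' - X * Z' + Z * X' ∧
      2 * D = a * Z' + Z * a' + X * Y' - Y * X' := by
  subst hX hY hZ hX' hY' hZ' he
  refine ⟨-a*b' - b'*p*x - a'*b - b*p*x' - 2*b*b' - 2*a*a'*v - 2*a*p*v*y' - 2*a*c'*v - 2*a'*p*v*y -
    2*c'*p*v*y - 2*a'*c*v - 2*c*p*v*y' - 4*c*c'*v + a*a' + a*p*y' + a*c' + a'*p*y + c'*p*y + a'*c +
    c*p*y' + 2*c*c' - a*p*v*x' - 2*a*d'*v - a'*p*v*x - 2*d'*p*v*x - 2*d'*p*v*y - 2*a'*d*v -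
    2*d*p*v*x' - 2*d*p*v*y' - 4*d*d'*v + a*d' + d'*p*x + d'*p*y + a'*d + d*p*x' + d*p*y' + 2*d*d' -
    4*v*w*y*y' + 2*w*y*y' - 2*v*w*x*x' - 2*v*w*x*y' - 2*v*w*x'*y + w*x*y' + w*x'*y,
    a*a' + a*b' + a'*p*x + a'*b + a*p*v*x' + 2*a*d'*v + 2*d'*p*v*y + 2*a'*c*v + 2*c*p*v*x' +
    2*c*p*v*y' + 4*c*d'*v - 2*a*c'*v - a'*p*v*x - 2*c'*p*v*x - 2*c'*p*v*y - 2*a'*d*v - 2*d*p*v*y' -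
    4*c'*d*v - a*d' - d'*p*y - a'*c - c*p*x' - c*p*y' - 2*c*d' + a*c' + c'*p*x + c'*p*y + a'*d +
    d*p*y' + 2*c'*d + 2*v*w*x'*y - 2*v*w*x*y' - w*x'*y + w*x*y',
    a*a' + a*c' + a'*p*y + a'*c - a*d' - d'*p*x - a'*b - b*p*x' - b*p*y' - 2*b*d' + a*b' + b'*p*x +
    b'*p*y + a'*d + d*p*x' + 2*b'*d - w*x*y' + w*x'*y,
    a*a' + a*p*y' + a*d' + a'*p*x + a'*d + a*c' + c'*p*x + a'*b + b*p*y' + 2*b*c' - a*b' - b'*p*y -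
    a'*c - c*p*x' - 2*b'*c + w*x*y' - w*x'*y, ?_,
    by linear_combination (4*v*y*y' - 2*y*y' + 2*v*x*x' + 2*v*x*y' + 2*v*x'*y - x*y' - x'*y) * hp,
    by linear_combination (-2*v*x'*y + 2*v*x*y' + x'*y - x*y') * hp,
    by linear_combination (x*y' - x'*y) * hp,
    by linear_combination (-x*y' + x'*y) * hp⟩
  exact ⟨a'*x + c*x' + c'*x + b'*x + b*x' + a*y' + a'*y + d'*x + d*x',
    b*y' + b'*y + a*y' + c'*y + c*y' + a*v*x' + a'*v*x + d'*y + d*y',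
    ⟨a*b' + a'*b + a*p*v*x' + 2*a*d'*v + 2*d'*p*v*y + 2*a'*c*v + c*p*v*x' + 2*c*p*v*y' + 2*c*d'*v -
    c'*p*v*x - 2*c'*d*v - a*d' - d'*p*y - a'*c - c*p*x' - c*p*y' - c*d' + c'*d + 2*v*w*x'*y - w*x'*y
    + b*b' + a*a'*v + a*p*v*y' + a'*p*v*y + 2*c*c'*v - a*p*y' - a'*p*y - c*c' + d'*p*v*x + d*p*v*x'
    + 2*d*d'*v - d'*p*x - d*p*x' - d*d' + 2*v*w*y*y' - w*y*y' + v*w*x*x',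
    by ring⟩,
    ⟨-a*d' - d'*p*x - b*p*y' - b*d' + a*b' + b'*p*x + b'*d - w*x*y' + b*b' + a*a'*v + a*p*v*y' +
    a*c'*v + a'*p*v*y + c'*p*v*y + a'*c*v + c*p*v*y' + 2*c*c'*v - a*p*y' - c'*p*y - c*p*y' - c*c' +
    a*d'*v + d'*p*v*x + d'*p*v*y + a'*d*v + d*p*v*x' + d*p*v*y' + 2*d*d'*v - d'*p*y - d*p*y' - d*d'
    + 2*v*w*y*y' - w*y*y' + v*w*x*x' + v*w*x*y' + v*w*x'*y,
    by ring⟩,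
    ⟨a'*b + b*c' - b'*p*y - a'*c - c*p*x' - b'*c - w*x'*y + b*b' + a*a'*v + a*p*v*y' + a*c'*v +
    a'*p*v*y + c'*p*v*y + a'*c*v + c*p*v*y' + 2*c*c'*v - a'*p*y - c'*p*y - c*p*y' - c*c' + a*d'*v +
    d'*p*v*x + d'*p*v*y + a'*d*v + d*p*v*x' + d*p*v*y' + 2*d*d'*v - d'*p*x - d'*p*y - d*p*x' -
    d*p*y' - d*d' + 2*v*w*y*y' - w*y*y' + v*w*x*x' + v*w*x*y' + v*w*x'*y - a*p*y',
    by ring⟩⟩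

lemma isHalfOrder_hurwitzLattice {p : R} (hp : 2 ∣ p ^ 2) (he : 2 ∣ e + 1) :
    IsHalfOrder (hurwitzLattice e p) where
  two_mem x := ⟨0, 0, ⟨x.imI - x.re, by simp; ring⟩, ⟨x.imJ - x.re, by simp; ring⟩,
    ⟨x.imK - x.re, by simp; ring⟩⟩
  mul_mem := by
    rintro X ⟨β, γ, ⟨x, hx⟩, ⟨y, hy⟩, ⟨z, hz⟩⟩ Y ⟨β', γ', ⟨x', hx'⟩, ⟨y', hy'⟩, ⟨z', hz'⟩⟩
    obtain ⟨w, hw⟩ := hp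
    obtain ⟨v, hv⟩ := he
    exact exists_half_mul (hurwitzLattice_mul (w := w) (v := v) (x := β) (y := γ) (b := x)
      (c := y) (d := z) (x' := β') (y' := γ') (b' := x') (c' := y') (d' := z')
      hw (by linear_combination hv) (by linear_combination hx) (by linear_combination hy)
      (by linear_combination hz) (by linear_combination hx') (by linear_combination hy')
      (by linear_combination hz'))

lemma crossLattice_mul {p m n y a b c d a' b' c' d' : R}
    (hp : p ^ 2 = 2 * (1 + p * m + 2 * n)) (he : e = 2 * y - (1 + p * m + 2 * n))
    {B D B' D' : R} (hB : B = p * c - a + 2 * b) (hD : D = p * a - c + 2 * d)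
    (hB' : B' = p * c' - a' + 2 * b') (hD' : D' = p * a' - c' + 2 * d') :
    ∃ t u v w : R, (⟨t, u, v, w⟩ : ℍ[R, -1, -e]) ∈ crossLattice e p ∧
      2 * t = a * a' - B * B' - e * c * c' - e * D * D' ∧
      2 * u = a * B' + B * a' + e * (c * D' - D * c') ∧
      2 * v = a * c' + c * a' - B * D' + D * B' ∧
      2 * w = a * D' + D * a' + B * c' - c * B' := by
  subst hB hD hB' hD' he
  refine ⟨-b'*c*p + a*b' - b*c'*p + a'*b - 2*b*b' - 2*c*c'*y + a*c'*p*y - 2*a*d'*p*y + a'*c*p*y + 2*c*d'*y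
    - 2*a'*d*p*y + 2*c'*d*y - 4*d*d'*y - c*d'*m*p - c'*d*m*p + 2*d*d'*m*p + a*d'*p - c*d' + a'*d*p -
    c'*d + 2*d*d' - a*c'*n*p + 2*a*d'*n*p - a'*c*n*p - 2*c*d'*n + 2*a'*d*n*p - 2*c'*d*n + 4*d*d'*n -
    2*a*a'*m*p*y - 2*a*a'*y - 4*a*a'*n*y + 2*a*a'*m*p + 4*a*a'*m*n*p - a*c'*m^2*p - a*c'*m -
    2*a*c'*m*n + 2*a*d'*m^2*p + 2*a*d'*m + 4*a*d'*m*n - a'*c*m^2*p - a'*c*m - 2*a'*c*m*n +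
    2*a'*d*m^2*p + 2*a'*d*m + 4*a'*d*m*n + a*a' + 4*a*a'*n + 4*a*a'*n^2 + 2*a*a'*m^3*p + 2*a*a'*m^2
    + 4*a*a'*m^2*n,
    a*c'*p - a*a' + a*b' + a'*b + a'*c*p*y + 2*c*d'*y - a*c'*p*y - 2*c'*d*y - c*d'*m*p + c'*d*m*p -
    c*d' + c'*d - a'*c*n*p - 2*c*d'*n + a*c'*n*p + 2*c'*d*n - a'*c*m^2*p - a'*c*m - 2*a'*c*m*n +
    a*c'*m^2*p + a*c'*m + 2*a*c'*m*n,
    -c*d'*p + a*d' - a'*b*p + b*c' - 2*b*d' + a*b'*p - b'*c + c'*d*p - a'*d + 2*b'*d - a'*c*m*p -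
    2*a'*c*n + a*c'*m*p + a*c' + 2*a*c'*n,
    a*a'*p - a*c' + a*d' + a'*d + b*c' - b'*c, ?_,
    by linear_combination (c*c' + 2*a*a'*y - a*a'*m*p + a*c'*m - 2*a*d'*m + a'*c*m - 2*a'*d*m -
      a*a' - 2*a*a'*n - 2*a*a'*m^2) * hp,
    by linear_combination (a'*c*m - a*c'*m) * hp,
    by linear_combination (a'*c - a*c') * hp,
    by ring⟩
  exact ⟨⟨-b*c'*p + 2*a'*b - b*b' - c*c'*y - a*d'*p*y + a'*c*p*y + 2*c*d'*y - a'*d*p*y - 2*d*d'*y +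
    d*d'*m*p + a'*d*p + d*d' + a*d'*n*p + a'*d*n*p + 2*d*d'*n - a*a'*m*p*y - a*a'*y - 2*a*a'*n*y +
    a*a'*m*p + 2*a*a'*m*n*p + a*d'*m^2*p + a*d'*m + 2*a*d'*m*n + a'*d*m^2*p + a'*d*m + 2*a'*d*m*n +
    2*a*a'*n + 2*a*a'*n^2 + a*a'*m^3*p + a*a'*m^2 + 2*a*a'*m^2*n + b*d'*p - b'*d*p - a*c'*n*p +
    a'*b*m*p + 2*a'*b*n - a*b'*m*p - 2*a*b'*n - c'*d*m*p - c'*d - 2*c'*d*n - a*c'*m^2*p - a*c'*m -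
    2*a*c'*m*n,
    by linear_combination (c*d' + a'*b - a*b' - c'*d + a'*c*m - a*c'*m) * hp⟩,
    ⟨-a'*b*p + 2*b*c' - b*d' + c'*d*p + b'*d + a*c'*m*p + 2*a*c'*n + b*b'*p + c*c'*p*y - c*d'*p*y -
    c'*d*p*y + 2*d*d'*p*y - d*d'*p + c*d'*n*p + c'*d*n*p - 2*d*d'*n*p + a*a'*p*y + 2*a*a'*n*p*y +
    2*a*c'*m*n*p - 2*a*d'*m*p - 4*a*d'*m*n*p + 2*a'*c*m*n*p - 2*a'*d*m*p - 4*a'*d*m*n*p - 2*a*a'*n*p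
    - 2*a*a'*n^2*p - 3*a*a'*m^2*p - 6*a*a'*m^2*n*p + b'*c*m*p + 2*b'*c*n + b*c'*m*p + 2*b*c'*n -
    a*c'*m*p*y - a*c'*y - 2*a*c'*n*y + 2*a*d'*m*p*y + 2*a*d'*y + 4*a*d'*n*y - a'*c*m*p*y - a'*c*y -
    2*a'*c*n*y + 2*a'*d*m*p*y + 2*a'*d*y + 4*a'*d*n*y + c*d'*m^2*p + c*d'*m + 2*c*d'*m*n +
    c'*d*m^2*p + c'*d*m + 2*c'*d*m*n - 2*d*d'*m^2*p - 2*d*d'*m - 4*d*d'*m*n - 4*a*d'*n - a'*d -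
    4*a'*d*n + 2*a*c'*n^2 - 4*a*d'*n^2 + 2*a'*c*n^2 - 4*a'*d*n^2 + 2*a*a'*m^2*p*y + 2*a*a'*m*y +
    4*a*a'*m*n*y - 2*a*a'*m - 8*a*a'*m*n - 8*a*a'*m*n^2 + a*c'*m^3*p + a*c'*m^2 + 2*a*c'*m^2*n -
    2*a*d'*m^3*p - 2*a*d'*m^2 - 4*a*d'*m^2*n + a'*c*m^3*p + a'*c*m^2 + 2*a'*c*m^2*n - 2*a'*d*m^3*p -
    2*a'*d*m^2 - 4*a'*d*m^2*n - 2*a*a'*m^4*p - 2*a*a'*m^3 - 4*a*a'*m^3*n,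
    by linear_combination (b'*c + b*c' - a*c'*y + 2*a*d'*y - a'*c*y + 2*a'*d*y + c*d'*m + c'*d*m -
      2*d*d'*m - a*d' - a'*d + a*c'*n - 2*a*d'*n + a'*c*n - 2*a'*d*n + 2*a*a'*m*y - 2*a*a'*m -
      4*a*a'*m*n + a*c'*m^2 - 2*a*d'*m^2 + a'*c*m^2 - 2*a'*d*m^2 - 2*a*a'*m^3) * hp⟩⟩

lemma isHalfOrder_crossLattice {p m n w : R} (hp : p ^ 2 = 2 * w)
    (hw : w = 1 + p * m + 2 * n) (he : 2 ∣ e + w) : IsHalfOrder (crossLattice e p) where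
  two_mem x := ⟨⟨x.re + x.imI - p * x.imJ, by simp; ring⟩,
    ⟨x.imJ + x.imK - p * x.re, by simp; ring⟩⟩
  mul_mem := by
    rintro X ⟨⟨x, hx⟩, ⟨y, hy⟩⟩ Y ⟨⟨x', hx'⟩, ⟨y', hy'⟩⟩
    obtain ⟨z, hz⟩ := he
    exact exists_half_mul (crossLattice_mul (m := m) (n := n) (y := z) (b := x) (d := y)
      (b' := x') (d' := y') (by rw [hp, hw]) (by linear_combination hz - hw)
      (by linear_combination hx) (by linear_combination hy)
      (by linear_combination hx') (by linear_combination hy'))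

end HalfIntegralLattices

section Classification

/-- An additive subgroup covered by two subgroups lies in one of them. -/
lemma le_or_le_of_forall_mem_or {A : Type*} [AddGroup A] {S L M : AddSubgroup A}
    (h : ∀ x ∈ S, x ∈ L ∨ x ∈ M) : S ≤ L ∨ S ≤ M := by
  by_contra! hc
  obtain ⟨⟨x, hx, hxL⟩, ⟨y, hy, hyM⟩⟩ :=
    (⟨SetLike.not_le_iff_exists.1 hc.1, SetLike.not_le_iff_exists.1 hc.2⟩ :
      (∃ x ∈ S, x ∉ L) ∧ ∃ y ∈ S, y ∉ M)
  have hxM := (h x hx).resolve_left hxL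
  have hyL := (h y hy).resolve_right hyM
  rcases h (x + y) (S.add_mem hx hy) with hs | hs
  · exact hxL ((L.add_mem_cancel_right hyL).1 hs)
  · exact hyM ((M.add_mem_cancel_left hxM).1 hs)

variable {R : Type*} [CommRing R] {e : R}

/-- A family of half-orders, permuted by `rotate`, which represents every subgroup of
`ℍ[R, -1, -e]` with norms divisible by `4` in exactly one way if it is maximal. -/
structure IsClassification {ι : Type*} (L : ι → AddSubgroup ℍ[R, -1, -e]) (τ : ι → ι) :
    Prop where
  isHalfOrder : ∀ t, IsHalfOrder (L t)
  cover : ∀ S : AddSubgroup ℍ[R, -1, -e], (∀ x ∈ S, 4 ∣ quatNorm x) → ∃ t, S ≤ L t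
  antichain : ∀ s t, L s ≤ L t → s = t
  involutive : Function.Involutive τ
  rotate_mem : ∀ t, ∀ x ∈ L t, rotate x ∈ L (τ t)

lemma rotate_mem_lineLattice {s ν : R} {x : ℍ[R, -1, -e]} (hx : x ∈ lineLattice e s ν) :
    rotate x ∈ lineLattice e s (ν + s) := by
  obtain ⟨⟨m, hm⟩, ⟨n, hn⟩⟩ := hx
  exact ⟨⟨m - s * x.imK, by simp only [rotate]; linear_combination hm⟩,
    ⟨n - (ν + s) * x.imK, by simp only [rotate]; linear_combination hn⟩⟩

lemma rotate_mem_lineLattice' {s ν : R} {x : ℍ[R, -1, -e]}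
    (hx : x ∈ lineLattice e s (ν + s)) : rotate x ∈ lineLattice e s ν := by
  obtain ⟨⟨m, hm⟩, ⟨n, hn⟩⟩ := hx
  exact ⟨⟨m - s * x.imK, by simp only [rotate]; linear_combination hm⟩,
    ⟨n - s * x.imJ - s * x.imK - ν * x.imK, by simp only [rotate]; linear_combination hn⟩⟩

lemma rotate_mem_splitLattice {g : R} (hg : 2 ∣ g ^ 2 + 1) {x : ℍ[R, -1, -e]}
    (hx : x ∈ splitLattice e g) : rotate x ∈ splitLattice e g := by
  obtain ⟨⟨m, hm⟩, ⟨n, hn⟩⟩ := hx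
  obtain ⟨k, hk⟩ := hg
  exact ⟨⟨m, hm⟩, ⟨k * x.imJ + g * n, by
    simp only [rotate]; linear_combination x.imJ * hk + g * hn⟩⟩

lemma rotate_mem_crossLattice {p : R} (hp : 2 ∣ p ^ 2) {x : ℍ[R, -1, -e]}
    (hx : x ∈ crossLattice e p) : rotate x ∈ crossLattice e p := by
  obtain ⟨⟨m, hm⟩, ⟨n, hn⟩⟩ := hx
  obtain ⟨k, hk⟩ := hp
  exact ⟨⟨m + p * n + k * x.re, by
    simp only [rotate]; linear_combination hm + p * hn + x.re * hk⟩,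
    ⟨n - x.imK, by simp only [rotate]; linear_combination hn⟩⟩

lemma rotate_mem_hurwitzLattice {p : R} {x : ℍ[R, -1, -e]}
    (hx : x ∈ hurwitzLattice e p) : rotate x ∈ hurwitzLattice e p := by
  obtain ⟨β, γ, ⟨l, hl⟩, ⟨m, hm⟩, ⟨n, hn⟩⟩ := hx
  exact ⟨β, β + γ, ⟨l, hl⟩,
    ⟨-n - x.re - p * β - p * γ, by simp only [rotate]; linear_combination -hn⟩,
    ⟨m - p * β, by simp only [rotate]; linear_combination hm⟩⟩

lemma four_dvd_line_add {s ν : R} (h : 4 ∣ e + s ^ 2 + 2 * s * ν + 2 * ν ^ 2) :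
    4 ∣ e + s ^ 2 + 2 * s * (ν + s) + 2 * (ν + s) ^ 2 := by
  obtain ⟨z, hz⟩ := h
  exact ⟨z + s ^ 2 + s * ν, by linear_combination hz⟩

/-- Reduction of the norm condition modulo `2` and `4`. -/
lemma dvd_of_four_dvd_quatNorm [IsDomain R] (h2 : (2 : R) ≠ 0)
    (hrad : ∀ y : R, 2 ∣ y ^ 2 → 2 ∣ y) {s ν : R}
    (h : 4 ∣ e + s ^ 2 + 2 * s * ν + 2 * ν ^ 2) {x : ℍ[R, -1, -e]} (hx : 4 ∣ quatNorm x) :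
    2 ∣ x.re + x.imI + s * (x.imJ + x.imK) ∧
      2 ∣ (x.re + s * x.imJ + ν * (x.imJ + x.imK)) *
        (x.re + s * x.imJ + (ν + s) * (x.imJ + x.imK)) := by
  obtain ⟨a, b, c, d⟩ := x
  obtain ⟨z, hz⟩ := h
  obtain ⟨k, hk⟩ := hx
  simp only [quatNorm] at hk ⊢
  obtain ⟨m, hm⟩ : 2 ∣ a + b + s * (c + d) := by
    apply hrad
    refine ⟨2 * k + a * b + a * s * (c + d) + b * s * (c + d) + s ^ 2 * (c + d) ^ 2
      + e * c * d - (c + d) ^ 2 * (2 * z - s * ν - ν ^ 2), ?_⟩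
    linear_combination hk - (c + d) ^ 2 * hz
  refine ⟨⟨m, hm⟩, ?_⟩
  obtain ⟨q, rfl⟩ : ∃ q, d = q - c := ⟨c + d, by ring⟩
  obtain rfl : b = 2 * m - s * q - a := by linear_combination hm
  obtain rfl : e = 4 * z - 2 * ν ^ 2 - 2 * s * ν - s ^ 2 := by linear_combination hz
  refine ⟨a ^ 2 + a * c * s + a * q * ν + a * q * s + 2 * c * q * s * ν + c * q * s ^ 2 + m ^ 2
    - m * q * s - a * m + 2 * c ^ 2 * z + q ^ 2 * z - 2 * c * q * z - c ^ 2 * ν ^ 2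
    + c * q * ν ^ 2 - c ^ 2 * s * ν - k, ?_⟩
  apply mul_left_cancel₀ h2
  linear_combination -hk

lemma lineLattice_not_le {s ν μ : R} (hs : ¬ 2 ∣ μ - ν) :
    ¬ lineLattice e s ν ≤ lineLattice e s μ := fun h => hs <| by
  obtain ⟨-, k, hk⟩ := h (x := ⟨-s - ν, ν, 1, 0⟩) ⟨⟨0, by simp⟩, ⟨0, by simp; ring⟩⟩
  exact ⟨k, by linear_combination hk⟩

/-- The case where `2` is inert. -/
lemma isClassification_inert [IsDomain R] (h2 : (2 : R) ≠ 0)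
    (hprime : ∀ x y : R, 2 ∣ x * y → 2 ∣ x ∨ 2 ∣ y) {s ν : R} (hs : ¬ 2 ∣ s)
    (h : 4 ∣ e + s ^ 2 + 2 * s * ν + 2 * ν ^ 2) :
    IsClassification (fun t : Bool => lineLattice e s (bif t then ν + s else ν)) not where
  isHalfOrder
    | false => isHalfOrder_lineLattice h
    | true => isHalfOrder_lineLattice (four_dvd_line_add h)
  cover S hS := by
    have key : ∀ x ∈ S, x ∈ lineLattice e s ν ∨ x ∈ lineLattice e s (ν + s) := by
      intro x hx
      obtain ⟨h1, h3⟩ := dvd_of_four_dvd_quatNorm h2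
        (fun y hy => (hprime y y (by rwa [← sq])).elim id id) h (hS x hx)
      exact (hprime _ _ h3).imp (fun h4 => ⟨h1, h4⟩) (fun h4 => ⟨h1, h4⟩)
    exact (le_or_le_of_forall_mem_or key).elim (fun h => ⟨false, h⟩) (fun h => ⟨true, h⟩)
  antichain := by
    rintro (_ | _) (_ | _) hle
    · rfl
    · exact absurd hle (lineLattice_not_le (by simpa using hs))
    · exact absurd hle (lineLattice_not_le (by simpa using hs))
    · rfl
  involutive := Bool.involutive_not
  rotate_mem
    | false, _, hx => rotate_mem_lineLattice hx
    | true, _, hx => rotate_mem_lineLattice' hx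

lemma zmod_two_cases (x : ZMod 2) : x = 0 ∨ x = 1 := by revert x; decide

section Split

variable {φ ψ : R →+* ZMod 2} (hφψ : ∀ x, 2 ∣ x ↔ φ x = 0 ∧ ψ x = 0)
include hφψ

lemma two_dvd_of_sq_of_split (y : R) (hy : 2 ∣ y ^ 2) : 2 ∣ y := by
  rw [hφψ, map_pow, map_pow] at hy
  exact (hφψ y).2 ⟨eq_zero_of_pow_eq_zero hy.1, eq_zero_of_pow_eq_zero hy.2⟩

/-- The case where `2` splits and `e ≡ 1 (mod 4)`. -/
lemma isClassification_split_one [IsDomain R] (h2 : (2 : R) ≠ 0) (he : 4 ∣ e - 1) :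
    IsClassification (fun _ : Unit => hurwitzLattice e 0) id where
  isHalfOrder _ := isHalfOrder_hurwitzLattice (by simp) (by
    obtain ⟨k, hk⟩ := he
    exact ⟨2 * k + 1, by linear_combination hk⟩)
  cover S hS := by
    refine ⟨(), fun x hx => ?_⟩
    obtain ⟨a, b, c, d⟩ := x
    obtain ⟨k, hk⟩ := hS _ hx
    obtain ⟨z, hz⟩ := he
    simp only [quatNorm] at hk
    obtain ⟨m, hm⟩ : 2 ∣ a + b + (c + d) := by
      apply two_dvd_of_sq_of_split hφψ
      exact ⟨2 * k - 2 * z * (c ^ 2 + d ^ 2) + a * b + a * (c + d) + b * (c + d) + c * d, by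
        linear_combination hk - (c ^ 2 + d ^ 2) * hz⟩
    obtain ⟨q, rfl⟩ : ∃ q, d = q - c := ⟨c + d, by ring⟩
    obtain rfl : b = 2 * m - q - a := by linear_combination hm
    obtain rfl : e = 4 * z + 1 := by linear_combination hz
    have hQ : (2 : R) * ((a + c) ^ 2 + (a + c) * q + q ^ 2 + 2 * (m ^ 2 - m * q - m * a
        + z * (2 * c ^ 2 - 2 * c * q + q ^ 2) - k - a * c - c * q)) = 0 := by
      linear_combination hk
    have hQ' := (mul_eq_zero.1 hQ).resolve_left h2
    have hφ2 : φ 2 = 0 := ((hφψ 2).1 dvd_rfl).1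
    have hψ2 : ψ 2 = 0 := ((hφψ 2).1 dvd_rfl).2
    have aniso : ∀ r q : ZMod 2, r ^ 2 + r * q + q ^ 2 = 0 → r = 0 ∧ q = 0 := by decide
    have hφ := aniso (φ (a + c)) (φ q) (by simpa [hφ2] using congrArg φ hQ')
    have hψ := aniso (ψ (a + c)) (ψ q) (by simpa [hψ2] using congrArg ψ hQ')
    obtain ⟨r, hr⟩ := (hφψ (a + c)).2 ⟨hφ.1, hψ.1⟩
    obtain ⟨t, rfl⟩ := (hφψ q).2 ⟨hφ.2, hψ.2⟩
    exact ⟨0, 0, ⟨m - t - a, by ring⟩, ⟨r - a, by linear_combination hr⟩,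
      ⟨t - r, by linear_combination -hr⟩⟩
  antichain _ _ _ := rfl
  involutive _ := rfl
  rotate_mem _ _ hx := rotate_mem_hurwitzLattice hx

/-- The case where `2` splits and `e ≡ -1 (mod 4)`. -/
lemma isClassification_split_three [IsDomain R] (h2 : (2 : R) ≠ 0) (he : 4 ∣ e + 1)
    {ω : R} (hω : φ ω = 0) (hω' : ψ ω = 1) :
    IsClassification (fun t : Bool × Bool =>
      lineLattice e 1 ((bif t.1 then ω else 0) + (bif t.2 then 1 else 0)))
      (Prod.map id not) := by
  set ν : Bool × Bool → R := fun t => (bif t.1 then ω else 0) + (bif t.2 then 1 else 0) with hν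
  have hφ2 : φ 2 = 0 := ((hφψ 2).1 dvd_rfl).1
  have hψ2 : ψ 2 = 0 := ((hφψ 2).1 dvd_rfl).2
  have hsq : ∀ x : ZMod 2, x ^ 2 + x = 0 := by decide
  have h4 : ∀ y : R, 4 ∣ e + 1 ^ 2 + 2 * 1 * y + 2 * y ^ 2 := fun y => by
    obtain ⟨z, hz⟩ := he
    obtain ⟨w, hw⟩ := (hφψ (y ^ 2 + y)).2 ⟨by rw [map_add, map_pow, hsq],
      by rw [map_add, map_pow, hsq]⟩
    exact ⟨z + w, by linear_combination hz + 2 * hw⟩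
  have hφν : ∀ t, φ (ν t) = bif t.2 then 1 else 0 := by
    rintro ⟨_ | _, _ | _⟩ <;> simp [hν, hω]
  have hψν : ∀ t, ψ (ν t) = (bif t.1 then 1 else 0) + (bif t.2 then 1 else 0) := by
    rintro ⟨_ | _, _ | _⟩ <;> simp [hν, hω']
  refine ⟨fun t => isHalfOrder_lineLattice (h4 _), fun S hS => ?_, fun s t hst => ?_,
    fun t => Prod.ext rfl (Bool.not_not _), ?_⟩
  · have key : ∀ x ∈ S, 2 ∣ x.re + x.imI + 1 * (x.imJ + x.imK) ∧
        2 ∣ (x.re + 1 * x.imJ + 0 * (x.imJ + x.imK)) *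
        (x.re + 1 * x.imJ + (0 + 1) * (x.imJ + x.imK)) := fun x hx =>
      dvd_of_four_dvd_quatNorm h2 (two_dvd_of_sq_of_split hφψ) (h4 0) (hS x hx)
    have split : ∀ χ : R →+* ZMod 2, (∀ x, 2 ∣ x → χ x = 0) →
        ∃ y : Bool, ∀ x ∈ S, χ (x.re + x.imJ) + (bif y then 1 else 0) * χ (x.imJ + x.imK) = 0 := by
      intro χ hχ
      let K : ZMod 2 → AddSubgroup ℍ[R, -1, -e] := fun y =>
        { carrier := {x | χ (x.re + x.imJ) + y * χ (x.imJ + x.imK) = 0}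
          zero_mem' := by simp
          add_mem' := fun {a b} ha hb => by
            simp only [Set.mem_ofPred_eq, map_add, QuaternionAlgebra.re_add,
              QuaternionAlgebra.imJ_add, QuaternionAlgebra.imK_add] at ha hb ⊢
            linear_combination ha + hb
          neg_mem' := fun {a} ha => by
            simp only [Set.mem_ofPred_eq, map_add, map_neg, QuaternionAlgebra.re_neg,
              QuaternionAlgebra.imJ_neg, QuaternionAlgebra.imK_neg] at ha ⊢
            linear_combination -ha }
      have hK : ∀ x ∈ S, x ∈ K 0 ∨ x ∈ K 1 := by
        intro x hx
        have h5 := hχ _ (key x hx).2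
        rw [map_mul] at h5
        refine (mul_eq_zero.1 h5).imp (fun h => ?_) (fun h => ?_)
        · change _ = _
          simpa using h
        · change _ = _
          simpa using h
      rcases le_or_le_of_forall_mem_or hK with h | h
      · exact ⟨false, fun x hx => h hx⟩
      · exact ⟨true, fun x hx => h hx⟩
    obtain ⟨y, hy⟩ := split φ fun x hx => ((hφψ x).1 hx).1
    obtain ⟨z, hz⟩ := split ψ fun x hx => ((hφψ x).1 hx).2
    refine ⟨(xor y z, y), fun x hx => ⟨(key x hx).1, (hφψ _).2 ⟨?_, ?_⟩⟩⟩
    · rw [map_add, map_mul φ (_ + _), hφν, one_mul]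
      exact hy x hx
    · rw [map_add, map_mul ψ (_ + _), hψν, one_mul]
      have hxor : ∀ y z : Bool, ((bif xor y z then 1 else 0) + (bif y then 1 else 0) : ZMod 2)
          = bif z then 1 else 0 := by decide
      rw [hxor]
      exact hz x hx
  · by_contra hne
    refine lineLattice_not_le (fun h => hne ?_) hst
    obtain ⟨h5, h6⟩ := (hφψ _).1 h
    rw [map_sub, hφν, hφν] at h5
    rw [map_sub, hψν, hψν] at h6
    have hinj : ∀ s t : Bool × Bool, ((bif t.2 then 1 else 0) - (bif s.2 then 1 else 0) : ZMod 2)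
        = 0 → ((bif t.1 then 1 else 0) + (bif t.2 then 1 else 0) - ((bif s.1 then 1 else 0)
        + (bif s.2 then 1 else 0)) : ZMod 2) = 0 → s = t := by decide
    exact hinj s t h5 h6
  · rintro ⟨x, _ | _⟩ y hy
    · have := rotate_mem_lineLattice hy
      simpa [hν] using this
    · refine rotate_mem_lineLattice' ?_
      simpa [hν] using hy

end Split
end Classification

section Ramified

variable {R : Type*} [CommRing R] {e : R}

/-- Data of a ramified prime above `2` with residue map `φ` onto the field with two elements:
the prime is `(2, p)` and `p ^ 2 = 2 w` with `w` a unit modulo the prime. -/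
structure IsRamified (φ : R →+* ZMod 2) (p w : R) : Prop where
  sq_eq : p ^ 2 = 2 * w
  map_eq_zero : ∀ x, φ x = 0 → ∃ y z, x = p * y + 2 * z
  map_two : φ 2 = 0
  map_p : φ p = 0
  map_w : φ w = 1
  of_dvd : ∀ x, 2 ∣ p * x → φ x = 0

namespace IsRamified

variable {φ : R →+* ZMod 2} {p w : R} (H : IsRamified φ p w)
include H

lemma map_of_dvd {x : R} (h : 2 ∣ x) : φ x = 0 := by
  obtain ⟨y, rfl⟩ := h
  rw [map_mul, H.map_two, zero_mul]

lemma dvd_mul {x : R} (h : φ x = 0) : 2 ∣ p * x := by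
  obtain ⟨y, z, rfl⟩ := H.map_eq_zero x h
  exact ⟨w * y + p * z, by linear_combination y * H.sq_eq⟩

lemma dvd_sq {x : R} (h : φ x = 0) : 2 ∣ x ^ 2 := by
  obtain ⟨y, z, rfl⟩ := H.map_eq_zero x h
  exact ⟨w * y ^ 2 + 2 * p * y * z + 2 * z ^ 2, by linear_combination y ^ 2 * H.sq_eq⟩

lemma dvd_sq_sub_one {x : R} (h : φ x = 1) : 2 ∣ x ^ 2 - 1 := by
  obtain ⟨y, hy⟩ := H.dvd_sq (x := x - 1) (by simp [h])
  exact ⟨y + x - 1, by linear_combination hy⟩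

lemma dvd_of_dvd_mul {x y : R} (hx : φ x = 1) (h : 2 ∣ x * y) : 2 ∣ y := by
  obtain ⟨k, hk⟩ := H.dvd_sq_sub_one hx
  obtain ⟨l, hl⟩ := h
  exact ⟨x * l - k * y, by linear_combination x * hl - y * hk⟩

variable {s u : R} {x : ℍ[R, -1, -e]}

lemma four_dvd_line (hs : 2 ∣ s ^ 2 - 1) (hu : e + s ^ 2 = 2 * u) (hu0 : φ u = 0) :
    4 ∣ e + s ^ 2 + 2 * s * (s * u) + 2 * (s * u) ^ 2 := by
  obtain ⟨k, hk⟩ := hs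
  obtain ⟨l, hl⟩ := H.dvd_sq hu0
  exact ⟨u + k * u + s ^ 2 * l, by linear_combination hu + 2 * u * hk + 2 * s ^ 2 * hl⟩

/-- The consequences of the norm condition when `e` is a square modulo `2`. -/
lemma exists_of_four_dvd_quatNorm [IsDomain R] (h2 : (2 : R) ≠ 0) (hs : φ s = 1)
    (hu : e + s ^ 2 = 2 * u) (hx : 4 ∣ quatNorm x) :
    ∃ m n, x.re + x.imI + s * (x.imJ + x.imK) = p * m + 2 * n ∧
      2 ∣ (x.re + s * x.imJ) ^ 2 + s * (x.imJ + x.imK) * (x.re + s * x.imJ)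
        + u * (x.imJ + x.imK) ^ 2 + w * m ^ 2 + p * m * (s * (x.imJ + x.imK) + x.re) := by
  obtain ⟨a, b, c, d⟩ := x
  obtain ⟨k, hk⟩ := hx
  simp only [quatNorm] at hk ⊢
  have he : φ e = 1 := by
    have := congrArg φ hu
    rw [map_add, map_pow, hs, map_mul, H.map_two, zero_mul] at this
    revert this
    generalize φ e = y
    revert y
    decide
  obtain ⟨m, n, hmn⟩ := H.map_eq_zero (a + b + s * (c + d)) (by
    have := congrArg φ hk
    simp only [map_add, map_mul, map_pow, he, hs, show φ 4 = 0 from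
      H.map_of_dvd ⟨2, by norm_num⟩] at this ⊢
    revert this
    generalize φ a = a
    generalize φ b = b
    generalize φ c = c
    generalize φ d = d
    generalize φ k = k
    revert a b c d k
    decide)
  refine ⟨m, n, hmn, ?_⟩
  obtain ⟨q, rfl⟩ : ∃ q, d = q - c := ⟨c + d, by ring⟩
  obtain rfl : b = p * m - s * q + 2 * n - a := by linear_combination hmn
  obtain rfl : e = 2 * u - s ^ 2 := by linear_combination hu
  refine ⟨a * c * s + c ^ 2 * s ^ 2 + m * p * q * s + a * m * p - m * n * p + n * q * s - n ^ 2
    + a * n - c ^ 2 * u + c * q * u + k, ?_⟩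
  apply mul_left_cancel₀ h2
  linear_combination hk - m ^ 2 * H.sq_eq

section Cases

variable [IsDomain R] (h2 : (2 : R) ≠ 0) (hs : φ s = 1) (hu : e + s ^ 2 = 2 * u)
  (hu0 : φ u = 0) (hx : 4 ∣ quatNorm x)
include h2 hs hu hu0 hx

lemma mem_line (hq : φ (x.imJ + x.imK) = 1) :
    (φ (x.re + x.imJ) = 0 → x ∈ lineLattice e s (s * u)) ∧
      (φ (x.re + x.imJ) = 1 → x ∈ lineLattice e s (s * u + s)) := by
  obtain ⟨m, n, hmn, hQ⟩ := H.exists_of_four_dvd_quatNorm h2 hs hu hx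
  simp only [mem_lineLattice]
  set q := x.imJ + x.imK
  set a := x.re
  set c := x.imJ
  have hm : φ m = 0 := by
    have := H.map_of_dvd hQ
    simp only [map_add, map_mul, map_pow, hq, hs, hu0, H.map_p, H.map_w] at this
    revert this
    generalize φ a = a
    generalize φ c = c
    generalize φ m = m
    revert a c m
    decide
  obtain ⟨k, hk⟩ := H.dvd_mul hm
  obtain ⟨l, hl⟩ := H.dvd_sq hm
  obtain ⟨t, ht⟩ := H.dvd_sq_sub_one hs
  obtain ⟨v, hv⟩ := H.dvd_sq hu0
  obtain ⟨z, hz⟩ := hQ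
  have h1 : 2 ∣ a + x.imI + s * q := ⟨k + n, by linear_combination hmn + hk⟩
  have hprod : 2 ∣ (a + s * c + s * u * q) * (a + s * c + (s * u + s) * q) := by
    refine ⟨z - w * l - k * (s * q + a) + s * u * q * (a + s * c) + s ^ 2 * q ^ 2 * v
      + q ^ 2 * t * u, ?_⟩
    linear_combination hz - w * hl - (s * q + a) * hk + s ^ 2 * q ^ 2 * hv + q ^ 2 * u * ht
  have hs' : ∀ y z : ZMod 2, y + z = 0 → y + 1 * z + (1 * 0 + 1) * 1 = 1 := by decide
  refine ⟨fun h => ⟨h1, H.dvd_of_dvd_mul (x := a + s * c + (s * u + s) * q) ?_ ?_⟩,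
    fun h => ⟨h1, H.dvd_of_dvd_mul ?_ hprod⟩⟩
  · simp only [map_add, map_mul, hs, hu0, hq] at h ⊢
    exact hs' _ _ h
  · rwa [mul_comm]
  · simp only [map_add, map_mul, hs, hu0, hq] at h ⊢
    simpa using h

lemma mem_hurwitz (hq : φ (x.imJ + x.imK) = 0) (hr : φ (x.re + x.imJ) = 0) :
    x ∈ hurwitzLattice e p := by
  obtain ⟨m, n, hmn, hQ⟩ := H.exists_of_four_dvd_quatNorm h2 hs hu hx
  obtain ⟨a, b, c, d⟩ := x
  simp only at hmn hQ hq hr ⊢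
  have hm : φ m = 0 := by
    have := H.map_of_dvd hQ
    simp only [map_add, map_mul, map_pow, hs, hu0, H.map_p, H.map_w] at this hq hr
    simp only [hq, one_mul] at this
    simpa [hr] using this
  obtain ⟨k, hk⟩ := H.dvd_mul hm
  obtain ⟨q₁, q₂, hq'⟩ := H.map_eq_zero _ hq
  obtain ⟨γ, z, hγ⟩ := H.map_eq_zero _ hr
  obtain ⟨l, hl⟩ := H.dvd_mul (x := (1 + s) * q₁) (by
    rw [map_mul, map_add, hs, map_one, show (1 + 1 : ZMod 2) = 0 by decide, zero_mul])
  refine ⟨-s * q₁, γ, ⟨k + n - a - s * q₂, ?_⟩, ⟨z - a, ?_⟩, ⟨q₂ + l - z - p * γ, ?_⟩⟩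
  · linear_combination hmn + hk - s * hq'
  · linear_combination hγ
  · linear_combination hq' + hl - hγ

/-- The relations satisfied in the remaining case. -/
lemma exists_of_odd (hq : φ (x.imJ + x.imK) = 0) (hr : φ (x.re + x.imJ) = 1)
    {w₁ w₂ : R} (hw : 1 + w = p * w₁ + 2 * w₂) :
    ∃ m n q₁ q₂, x.re + x.imI + s * (x.imJ + x.imK) = p * m + 2 * n ∧
      x.imJ + x.imK = p * q₁ + 2 * q₂ ∧ φ m = 1 ∧ φ w₁ + φ q₁ + φ x.re = 0 := by
  obtain ⟨m, n, hmn, hQ⟩ := H.exists_of_four_dvd_quatNorm h2 hs hu hx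
  obtain ⟨q₁, q₂, hq'⟩ := H.map_eq_zero _ hq
  obtain ⟨a, b, c, d⟩ := x
  simp only at hmn hQ hq hr hq' ⊢
  have hm : φ m = 1 := by
    have := H.map_of_dvd hQ
    simp only [map_add, map_mul, map_pow, hs, hu0, H.map_p, H.map_w] at this hq hr
    simp only [hq, one_mul] at this
    simp only [hr] at this
    revert this
    generalize φ m = m
    generalize φ a = a
    revert m a
    decide
  refine ⟨m, n, q₁, q₂, hmn, hq', hm, ?_⟩
  obtain ⟨k, hk⟩ := H.dvd_sq_sub_one hm
  obtain ⟨l, hl⟩ := H.dvd_sq_sub_one (x := a + s * c) (by simpa [hs] using hr)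
  obtain ⟨v, hv⟩ := H.dvd_sq hq
  obtain ⟨z, hz⟩ := hQ
  have := H.of_dvd (w₁ + s * q₁ * (a + s * c) + m * a) ⟨z - l - w * k - w₂ - u * v
      - s * q₂ * (a + s * c) - m * s * (w * q₁ + p * q₂), by
    linear_combination hz - hl - w * hk - hw - u * hv - s * (a + s * c) * hq'
      - p * m * s * hq' - m * s * q₁ * H.sq_eq⟩
  simp only [map_add, map_mul, hs, hm, one_mul] at this hr
  simpa [hr] using this

end Cases

lemma mem_cross [IsDomain R] (h2 : (2 : R) ≠ 0) (hs : φ s = 1) (hu : e + s ^ 2 = 2 * u)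
    (hu0 : φ u = 0) (hx : 4 ∣ quatNorm x) (hq : φ (x.imJ + x.imK) = 0)
    (hr : φ (x.re + x.imJ) = 1) {w₁ w₂ : R} (hw : 1 + w = p * w₁ + 2 * w₂) (hw₁ : φ w₁ = 0) :
    ¬ 2 ∣ x.re + x.imI + s * (x.imJ + x.imK) ∧ x ∈ crossLattice e p := by
  obtain ⟨m, n, q₁, q₂, hmn, hq', hm, hrel⟩ := H.exists_of_odd h2 hs hu hu0 hx hq hr hw
  rw [hw₁] at hrel
  rw [map_add] at hr
  refine ⟨fun ⟨k, hk⟩ => ?_, ?_, ?_⟩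
  · have := H.of_dvd m ⟨k - n, by linear_combination hk - hmn⟩
    simp [hm] at this
  · obtain ⟨k, hk⟩ := H.dvd_mul (x := m - s * q₁ - x.imJ) (by
      simp only [map_sub, map_mul, hm, hs]
      revert hrel hr
      generalize φ q₁ = y
      generalize φ x.re = a
      generalize φ x.imJ = c
      revert y a c
      decide)
    exact ⟨k + n - s * q₂, by linear_combination hmn + hk - s * hq'⟩
  · obtain ⟨k, hk⟩ := H.dvd_mul (x := q₁ - x.re) (by
      rw [map_sub]
      revert hrel
      generalize φ q₁ = y
      generalize φ x.re = a
      revert y a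
      decide)
    exact ⟨k + q₂, by linear_combination hk + hq'⟩

lemma mem_split [IsDomain R] (h2 : (2 : R) ≠ 0) (hs : φ s = 1) (hu : e + s ^ 2 = 2 * u)
    (hu0 : φ u = 0) (hx : 4 ∣ quatNorm x) (hq : φ (x.imJ + x.imK) = 0)
    (hr : φ (x.re + x.imJ) = 1) {w₁ w₂ : R} (hw : 1 + w = p * w₁ + 2 * w₂) (hw₁ : φ w₁ = 1) :
    ¬ 2 ∣ x.re + x.imI + s * (x.imJ + x.imK) ∧ x ∈ splitLattice e (p - 1) := by
  obtain ⟨m, n, q₁, q₂, hmn, hq', hm, hrel⟩ := H.exists_of_odd h2 hs hu hu0 hx hq hr hw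
  rw [hw₁] at hrel
  rw [map_add] at hr
  refine ⟨fun ⟨k, hk⟩ => ?_, ?_, ?_⟩
  · have := H.of_dvd m ⟨k - n, by linear_combination hk - hmn⟩
    simp [hm] at this
  · obtain ⟨k, hk⟩ := H.dvd_mul (x := m - s * q₁ - x.re) (by
      simp only [map_sub, map_mul, hm, hs]
      revert hrel hr
      generalize φ q₁ = y
      generalize φ x.re = a
      generalize φ x.imJ = c
      revert y a c
      decide)
    exact ⟨k + n - s * q₂, by linear_combination hmn + hk - s * hq'⟩
  · obtain ⟨k, hk⟩ := H.dvd_mul (x := q₁ - x.imJ) (by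
      rw [map_sub]
      revert hrel hr
      generalize φ q₁ = y
      generalize φ x.re = a
      generalize φ x.imJ = c
      revert y a c
      decide)
    exact ⟨k + q₂, by linear_combination hk + hq'⟩

lemma not_dvd {x : R} (hx : φ x ≠ 0) : ¬ 2 ∣ x := fun h => hx (H.map_of_dvd h)

/-- The classification when `e` is a square modulo `2`; the lattice `N` accounts for the
elements of odd trace part. -/
lemma isClassification_of_mem [IsDomain R] (h2 : (2 : R) ≠ 0) (hs : φ s = 1)
    (hs2 : 2 ∣ s ^ 2 - 1) (hu : e + s ^ 2 = 2 * u) (hu0 : φ u = 0)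
    {N : AddSubgroup ℍ[R, -1, -e]} (hN : IsHalfOrder N)
    (hrot : ∀ x ∈ N, rotate x ∈ N)
    (hNmem : ∀ x : ℍ[R, -1, -e], 4 ∣ quatNorm x → φ (x.imJ + x.imK) = 0 →
      φ (x.re + x.imJ) = 1 → ¬ 2 ∣ x.re + x.imI + s * (x.imJ + x.imK) ∧ x ∈ N)
    (hN0 : ∀ x ∈ N, φ (x.imJ + x.imK) = 0)
    (hN1 : ∃ x ∈ N, φ (x.re + x.imJ) = 1 ∧ ¬ 2 ∣ x.re + x.imI + s * (x.imJ + x.imK))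
    (hN2 : (⟨1, 1, 1, 1⟩ : ℍ[R, -1, -e]) ∉ N) :
    IsClassification
      ![lineLattice e s (s * u), lineLattice e s (s * u + s), N, hurwitzLattice e p]
      ![1, 0, 2, 3] := by
  have hH0 : ∀ x ∈ hurwitzLattice e p, φ (x.imJ + x.imK) = 0 ∧ φ (x.re + x.imJ) = 0 := by
    rintro ⟨a, b, c, d⟩ ⟨β, γ, h1, h2, h3⟩
    replace h2 := H.map_of_dvd h2
    replace h3 := H.map_of_dvd h3
    simp only [map_sub, map_add, map_mul, H.map_p, zero_mul, sub_zero] at *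
    revert h2 h3
    generalize φ a = a
    generalize φ c = c
    generalize φ d = d
    revert a c d
    decide
  have hwit : ∀ ν : R, (⟨-s - ν, ν, 1, 0⟩ : ℍ[R, -1, -e]) ∈ lineLattice e s ν := fun ν =>
    ⟨⟨0, by simp⟩, ⟨0, by simp; ring⟩⟩
  have hns : ¬ 2 ∣ s := H.not_dvd (by simp [hs])
  have hnp : ¬ 2 ∣ p := fun h => by simpa using H.of_dvd 1 (by simpa using h)
  have hlineN : ∀ ν, ¬ lineLattice e s ν ≤ N := fun ν hle => by
    simpa using hN0 _ (hle (hwit ν))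
  have hlineH : ∀ ν, ¬ lineLattice e s ν ≤ hurwitzLattice e p := fun ν hle => by
    simpa using (hH0 _ (hle (hwit ν))).1
  have hNline : ∀ ν, ¬ N ≤ lineLattice e s ν := fun ν hle => by
    obtain ⟨x, hx, -, hx'⟩ := hN1
    exact hx' (hle hx).1
  have hNH : ¬ N ≤ hurwitzLattice e p := fun hle => by
    obtain ⟨x, hx, hx', -⟩ := hN1
    have := (hH0 x (hle hx)).2
    simp [hx'] at this
  obtain ⟨t, ht⟩ := H.dvd_mul (x := 1 + s) (by rw [map_add, hs, map_one]; decide)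
  obtain ⟨t', ht'⟩ := H.dvd_mul (x := s * u) (by rw [map_mul, hu0, mul_zero])
  refine ⟨?_, fun S hS => ?_, ?_, ?_, ?_⟩
  · intro t
    fin_cases t
    · exact isHalfOrder_lineLattice (H.four_dvd_line hs2 hu hu0)
    · exact isHalfOrder_lineLattice (four_dvd_line_add (H.four_dvd_line hs2 hu hu0))
    · exact hN
    · refine isHalfOrder_hurwitzLattice ⟨w, H.sq_eq⟩ ?_
      obtain ⟨k, hk⟩ := hs2
      exact ⟨u - k, by linear_combination hu - hk⟩
  · have h01 : (0 : ZMod 2) ≠ 1 := by decide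
    have key := fun x hx => H.mem_line (x := x) h2 hs hu hu0 (hS x hx)
    by_cases hex : ∃ x ∈ S, φ (x.imJ + x.imK) = 1
    · obtain ⟨x, hx, hxq⟩ := hex
      obtain ⟨ν, i, hi, hxν, hν⟩ : ∃ ν : R, ∃ i : Fin 4, ![lineLattice e s (s * u),
          lineLattice e s (s * u + s), N, hurwitzLattice e p] i = lineLattice e s ν ∧
          x ∈ lineLattice e s ν ∧ ∀ y ∈ S, φ (y.imJ + y.imK) = 1 →
            φ (y.re + y.imJ) = φ (x.re + x.imJ) → y ∈ lineLattice e s ν := by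
        rcases zmod_two_cases (φ (x.re + x.imJ)) with h | h
        · exact ⟨_, 0, rfl, (key x hx hxq).1 h, fun y hy hyq hyr => (key y hy hyq).1 (hyr.trans h)⟩
        · exact ⟨_, 1, rfl, (key x hx hxq).2 h, fun y hy hyq hyr => (key y hy hyq).2 (hyr.trans h)⟩
      have hfst : ∀ y ∈ S, φ (y.imJ + y.imK) = 1 →
          2 ∣ y.re + y.imI + s * (y.imJ + y.imK) := fun y hy hyq => by
        rcases zmod_two_cases (φ (y.re + y.imJ)) with h | h
        · exact ((key y hy hyq).1 h).1
        · exact ((key y hy hyq).2 h).1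
      have heven : ∀ y ∈ S, φ (y.imJ + y.imK) = 0 → φ (y.re + y.imJ) = 0 := fun y hy hyq => by
        refine (zmod_two_cases _).resolve_right fun h => (hNmem y (hS y hy) hyq h).1 ?_
        have h3 := hfst _ (S.add_mem hx hy) (by
          simp only [QuaternionAlgebra.imJ_add, QuaternionAlgebra.imK_add, map_add] at hxq hyq ⊢
          linear_combination hxq + hyq)
        have h4 := dvd_sub h3 (hfst x hx hxq)
        simp only [QuaternionAlgebra.imJ_add, QuaternionAlgebra.imK_add,
          QuaternionAlgebra.re_add, QuaternionAlgebra.imI_add] at h4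
        convert h4 using 1
        ring
      refine ⟨i, hi ▸ fun y hy => ?_⟩
      rcases zmod_two_cases (φ (y.imJ + y.imK)) with hyq | hyq
      · refine (AddSubgroup.add_mem_cancel_left _ hxν).1 (hν (x + y) (S.add_mem hx hy) ?_ ?_)
        · simp only [QuaternionAlgebra.imJ_add, QuaternionAlgebra.imK_add, map_add] at hxq hyq ⊢
          linear_combination hxq + hyq
        · have := heven y hy hyq
          simp only [QuaternionAlgebra.imJ_add, QuaternionAlgebra.re_add, map_add] at this ⊢
          linear_combination this
      · refine hν y hy hyq ?_
        have h3 := heven (x - y) (S.sub_mem hx hy) (by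
          simp only [QuaternionAlgebra.imJ_sub, QuaternionAlgebra.imK_sub, map_add,
            map_sub] at hxq hyq ⊢
          linear_combination hxq - hyq)
        simp only [QuaternionAlgebra.imJ_sub, QuaternionAlgebra.re_sub, map_add, map_sub] at h3 ⊢
        linear_combination -h3
    · push Not at hex
      replace hex : ∀ x ∈ S, φ (x.imJ + x.imK) = 0 := fun x hx =>
        (zmod_two_cases _).resolve_right (hex x hx)
      by_cases hex' : ∃ x ∈ S, φ (x.re + x.imJ) = 1
      · obtain ⟨x, hx, hxr⟩ := hex'
        have hmem := fun y hy hyr => (hNmem y (hS y hy) (hex y hy) hyr).2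
        refine ⟨2, fun y hy => ?_⟩
        rcases zmod_two_cases (φ (y.re + y.imJ)) with hyr | hyr
        · refine (AddSubgroup.add_mem_cancel_left _ (hmem x hx hxr)).1
            (hmem _ (S.add_mem hx hy) ?_)
          simp only [QuaternionAlgebra.imJ_add, QuaternionAlgebra.re_add, map_add] at hxr hyr ⊢
          linear_combination hxr + hyr
        · exact hmem y hy hyr
      · push Not at hex'
        exact ⟨3, fun x hx => H.mem_hurwitz h2 hs hu hu0 (hS x hx) (hex x hx)
          ((zmod_two_cases _).resolve_right (hex' x hx))⟩
  · intro i j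
    fin_cases i <;> fin_cases j <;> intro hle
    · rfl
    · exact absurd hle (lineLattice_not_le (by simpa using hns))
    · exact absurd hle (hlineN _)
    · exact absurd hle (hlineH _)
    · exact absurd hle (lineLattice_not_le (by simpa using hns))
    · rfl
    · exact absurd hle (hlineN _)
    · exact absurd hle (hlineH _)
    · exact absurd hle (hNline _)
    · exact absurd hle (hNline _)
    · rfl
    · exact absurd hle hNH
    · refine absurd (hle (x := ⟨p, 0, 0, p⟩) ⟨1, 1, ⟨-p, by ring⟩, ⟨-p, by ring⟩,
        ⟨-p, by ring⟩⟩) fun ⟨_, h⟩ => hnp ?_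
      obtain ⟨k, hk⟩ := h
      exact ⟨k - t', by linear_combination hk - ht'⟩
    · refine absurd (hle (x := ⟨p, 0, p, 0⟩) ⟨1, 0, ⟨-p, by ring⟩, ⟨0, by ring⟩,
        ⟨-p, by ring⟩⟩) fun ⟨_, h⟩ => hnp ?_
      obtain ⟨k, hk⟩ := h
      refine ⟨k - t' - p * s, ?_⟩
      linear_combination hk - ht'
    · exact absurd (hle (x := ⟨1, 1, 1, 1⟩) ⟨0, 0, by simp⟩) hN2
    · rfl
  · intro i
    fin_cases i <;> rfl
  · intro i x hx
    fin_cases i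
    · exact rotate_mem_lineLattice hx
    · exact rotate_mem_lineLattice' hx
    · exact hrot x hx
    · exact rotate_mem_hurwitzLattice hx

lemma isClassification_cross [IsDomain R] (h2 : (2 : R) ≠ 0) (hs : φ s = 1)
    (hs2 : 2 ∣ s ^ 2 - 1) (hu : e + s ^ 2 = 2 * u) (hu0 : φ u = 0)
    {w₁ w₂ : R} (hw : 1 + w = p * w₁ + 2 * w₂) (hw₁ : φ w₁ = 0) :
    IsClassification ![lineLattice e s (s * u), lineLattice e s (s * u + s),
      crossLattice e p, hurwitzLattice e p] ![1, 0, 2, 3] := by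
  obtain ⟨k, hk⟩ := hs2
  obtain ⟨l, hl⟩ := H.dvd_mul hw₁
  have hnp : ¬ 2 ∣ p := fun h => by simpa using H.of_dvd 1 (by simpa using h)
  refine H.isClassification_of_mem h2 hs ⟨k, hk⟩ hu hu0
    (isHalfOrder_crossLattice (m := w₁) (n := w₂ - 1) H.sq_eq (by linear_combination hw)
      ⟨u - k + l + w₂ - 1, by linear_combination hu - hk + hl + hw⟩)
    (fun x hx => rotate_mem_crossLattice ⟨w, H.sq_eq⟩ hx)
    (fun x hx hq hr => H.mem_cross h2 hs hu hu0 hx hq hr hw hw₁) (fun x hx => ?_)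
    ⟨⟨1, -1, 0, p⟩, ⟨⟨0, by simp⟩, ⟨0, by simp⟩⟩, by simp, fun h => ?_⟩ ?_
  · have := H.map_of_dvd hx.2
    simpa [H.map_p] using this
  · have := H.of_dvd s (by simpa [mul_comm] using h)
    simp [hs] at this
  · rintro ⟨⟨y, hy⟩, -⟩
    exact hnp ⟨1 - y, by linear_combination -hy⟩

lemma isClassification_split [IsDomain R] (h2 : (2 : R) ≠ 0) (hs : φ s = 1)
    (hs2 : 2 ∣ s ^ 2 - 1) (hu : e + s ^ 2 = 2 * u) (hu0 : φ u = 0)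
    {w₁ w₂ : R} (hw : 1 + w = p * w₁ + 2 * w₂) (hw₁ : φ w₁ = 1)
    (hp : 4 ∣ (p - 1) ^ 2 + 1) :
    IsClassification ![lineLattice e s (s * u), lineLattice e s (s * u + s),
      splitLattice e (p - 1), hurwitzLattice e p] ![1, 0, 2, 3] := by
  have hnp : ¬ 2 ∣ p := fun h => by simpa using H.of_dvd 1 (by simpa using h)
  refine H.isClassification_of_mem h2 hs hs2 hu hu0 (isHalfOrder_splitLattice hp)
    (fun x hx => rotate_mem_splitLattice ((show (2 : R) ∣ 4 from ⟨2, by norm_num⟩).trans hp) hx)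
    (fun x hx hq hr => H.mem_split h2 hs hu hu0 hx hq hr hw hw₁) (fun x hx => ?_)
    ⟨⟨1, p - 1, 0, 0⟩, ⟨⟨0, by simp⟩, ⟨0, by simp⟩⟩, by simp, fun h => hnp ?_⟩ ?_
  · have := H.map_of_dvd hx.2
    simp only [map_sub, map_mul, H.map_p, map_one] at this
    rw [map_add]
    linear_combination this
  · simpa using h
  · rintro ⟨⟨y, hy⟩, -⟩
    exact hnp ⟨1 - y, by linear_combination -hy⟩

/-- The classification when `e` is not a square modulo `2`. -/
lemma isClassification_nonsquare [IsDomain R] (h2 : (2 : R) ≠ 0) (he : 2 ∣ e - (1 + p))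
    {w₁ w₂ : R} (hw : 1 + w = p * w₁ + 2 * w₂) (hw₁ : φ w₁ = 1)
    (hp : 4 ∣ (p - 1) ^ 2 + 1) :
    IsClassification (fun t : Bool => bif t then splitLattice e (p - 1) else crossLattice e p)
      id := by
  have hnp : ¬ 2 ∣ p := fun h => by simpa using H.of_dvd 1 (by simpa using h)
  have hφe : φ e = 1 := by simpa [H.map_p, sub_eq_zero] using H.map_of_dvd he
  obtain ⟨e', he'⟩ := he
  obtain ⟨l, hl⟩ := H.dvd_mul (x := w₁ + 1) (by rw [map_add, map_one, hw₁]; decide)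
  have hns : ¬ splitLattice e (p - 1) ≤ crossLattice e p := fun hle => by
    obtain ⟨⟨y, hy⟩, -⟩ := hle (x := ⟨1, p - 1, 0, 0⟩) ⟨⟨0, by simp⟩, ⟨0, by simp⟩⟩
    exact hnp ⟨y, by linear_combination hy⟩
  have hnc : ¬ crossLattice e p ≤ splitLattice e (p - 1) := fun hle => by
    obtain ⟨⟨y, hy⟩, -⟩ := hle (x := ⟨1, -1, 0, p⟩) ⟨⟨0, by simp⟩, ⟨0, by simp⟩⟩
    exact hnp ⟨-y, by linear_combination -hy⟩
  refine ⟨?_, fun S hS => ?_, ?_, fun _ => rfl, ?_⟩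
  · rintro (_ | _)
    · exact isHalfOrder_crossLattice (m := w₁) (n := w₂ - 1) H.sq_eq (by linear_combination hw)
        ⟨e' + l + w₂, by linear_combination he' + hl + hw⟩
    · exact isHalfOrder_splitLattice hp
  · suffices key : ∀ x ∈ S, x ∈ splitLattice e (p - 1) ∨ x ∈ crossLattice e p from
      (le_or_le_of_forall_mem_or key).elim (fun h => ⟨true, h⟩) (fun h => ⟨false, h⟩)
    intro x hx
    obtain ⟨a, b, c, d⟩ := x
    obtain ⟨k, hk⟩ := hS _ hx
    simp only [quatNorm] at hk
    simp only [mem_splitLattice, mem_crossLattice]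
    obtain ⟨q, rfl⟩ : ∃ q, d = q - c := ⟨c + d, by ring⟩
    obtain ⟨t, rfl⟩ : ∃ t, b = t - a := ⟨a + b, by ring⟩
    have htq : φ t = φ q := by
      have := congrArg φ hk
      simp only [map_add, map_mul, map_pow, map_sub, hφe, show φ 4 = 0 from
        H.map_of_dvd ⟨2, by norm_num⟩] at this
      revert this
      generalize φ a = a
      generalize φ t = t
      generalize φ c = c
      generalize φ q = q
      generalize φ k = k
      revert a t c q k
      decide
    have hq : φ q = 0 := by
      refine (zmod_two_cases _).resolve_right fun hq => hnp ?_
      obtain ⟨y, hy⟩ := H.dvd_sq_sub_one hq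
      obtain ⟨z, hz⟩ := H.dvd_sq_sub_one (htq.trans hq)
      refine ⟨2 * k - z - e * y - a ^ 2 + a * t - e * c ^ 2 + e * c * q - 1 - e', ?_⟩
      linear_combination hk - hz - e * hy - he'
    obtain ⟨p₁, p₂, rfl⟩ := H.map_eq_zero _ (htq.trans hq)
    obtain ⟨q₁, q₂, rfl⟩ := H.map_eq_zero _ hq
    have hk2 : a ^ 2 - a * p * p₁ - 2 * a * p₂ + w * p₁ ^ 2 + 2 * p * p₁ * p₂ + 2 * p₂ ^ 2
        + e * (c ^ 2 - c * p * q₁ - 2 * c * q₂ + w * q₁ ^ 2 + 2 * p * q₁ * q₂ + 2 * q₂ ^ 2)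
        = 2 * k := by
      apply mul_left_cancel₀ h2
      linear_combination hk - (p₁ ^ 2 + e * q₁ ^ 2) * H.sq_eq
    have hsum : φ a + φ p₁ + φ c + φ q₁ = 0 := by
      have := congrArg φ hk2
      simp only [map_add, map_sub, map_mul, map_pow, H.map_p, H.map_w, hφe, H.map_two] at this
      revert this
      generalize φ a = a
      generalize φ p₁ = b
      generalize φ c = c
      generalize φ q₁ = d
      generalize φ p₂ = b'
      generalize φ q₂ = d'
      generalize φ k = k
      revert a b c d b' d' k
      decide
    have hrel : φ p₁ + φ c + φ a * φ p₁ + φ c * φ q₁ = 0 := by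
      obtain ⟨y, hy⟩ := H.dvd_sq (x := a + p₁ + c + q₁) (by simpa using hsum)
      have := H.of_dvd (p₁ ^ 2 + c ^ 2 + a * p₁ + c * q₁)
        ⟨p * p₁ ^ 2 + a * p * p₁ + c * p * q₁ + a * p₂ - l * p₁ ^ 2 - p₁ ^ 2 * w₂ + p₁ ^ 2
          - p * p₁ * p₂ - p₂ ^ 2 + c * p * q₂ - l * p * q₁ ^ 2 - p * q₁ ^ 2 * w₂ + p * q₁ ^ 2
          - p * q₂ ^ 2 + c * q₂ - l * q₁ ^ 2 - q₁ ^ 2 * w₂ + q₁ ^ 2 - p * q₁ * q₂ - q₂ ^ 2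
          - c ^ 2 * e' + c * e' * p * q₁ + 2 * c * e' * q₂ - 2 * e' * l * q₁ ^ 2
          + e' * p * q₁ ^ 2 - 2 * e' * q₁ ^ 2 * w₂ + e' * q₁ ^ 2 - 2 * e' * p * q₁ * q₂
          - 2 * e' * q₂ ^ 2 + k + a * p₁ + a * c + a * q₁ + c * p₁ + p₁ * q₁ + c * q₁ - y
          + c * q₁ * w + q₁ ^ 2 * w - 2 * q₁ * q₂ * w, by
        linear_combination hk2 - (p₁ ^ 2 + e * q₁ ^ 2) * (hw + hl) - (c ^ 2 - c * p * q₁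
          - 2 * c * q₂ + (2 * l - p + 2 * w₂ - 1) * q₁ ^ 2 + 2 * p * q₁ * q₂ + 2 * q₂ ^ 2) * he'
          - hy + (c * q₁ + q₁ ^ 2 - 2 * q₁ * q₂) * H.sq_eq⟩
      have hsq : ∀ z : ZMod 2, z ^ 2 = z := by decide
      simpa only [map_add, map_mul, map_pow, hsq] using this
    have hmem : (φ (p₁ - a) = 0 ∧ φ (q₁ - c) = 0) ∨ (φ (p₁ - c) = 0 ∧ φ (q₁ - a) = 0) := by
      simp only [map_sub]
      revert hsum hrel
      generalize φ a = a
      generalize φ p₁ = b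
      generalize φ c = c
      generalize φ q₁ = d
      revert a b c d
      decide
    refine hmem.imp (fun ⟨h3, h4⟩ => ?_) (fun ⟨h3, h4⟩ => ?_) <;>
      obtain ⟨y, hy⟩ := H.dvd_mul h3 <;> obtain ⟨z, hz⟩ := H.dvd_mul h4
    · exact ⟨⟨y + p₂, by linear_combination hy⟩, ⟨z + q₂, by linear_combination hz⟩⟩
    · exact ⟨⟨y + p₂, by linear_combination hy⟩, ⟨z + q₂, by linear_combination hz⟩⟩
  · rintro (_ | _) (_ | _) hle
    · rfl
    · exact absurd hle hnc
    · exact absurd hle hns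
    · rfl
  · rintro (_ | _) x hx
    · exact rotate_mem_crossLattice ⟨w, H.sq_eq⟩ hx
    · exact rotate_mem_splitLattice ((show (2 : R) ∣ 4 from ⟨2, by norm_num⟩).trans hp) hx

end IsRamified

end Ramified

section Integrality

variable {K : Type*} [Field K] {A B : K}

/-- The reduced trace and norm of an integral quaternion are integral. -/
lemma isIntegral_trace_norm {h : ℍ[K, A, B]} (hh : IsIntegral ℤ h) :
    IsIntegral ℤ (2 * h.re) ∧ IsIntegral ℤ (h * star h).re := by
  have hstar : IsIntegral ℤ (star h) := by
    obtain ⟨f, hf, hf'⟩ := hh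
    refine ⟨f, hf, ?_⟩
    rw [← Polynomial.aeval_def, Polynomial.aeval_eq_sum_range] at hf' ⊢
    have := congrArg star hf'
    simpa [star_sum, Int.cast_comm] using this
  have hadd : h + star h = algebraMap K _ (2 * h.re) := by
    rw [QuaternionAlgebra.self_add_star']
    simp [QuaternionAlgebra.coe_algebraMap]
  have hmul : h * star h = algebraMap K _ (h * star h).re := by
    rw [QuaternionAlgebra.coe_algebraMap]
    exact QuaternionAlgebra.mul_star_eq_coe h
  have := Algebra.isMulCommutative_adjoin K (s := {h}) (by rintro a rfl b rfl; rfl)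
  have hmem : h ∈ Algebra.adjoin K {h} := Algebra.subset_adjoin rfl
  have hmem' : star h ∈ Algebra.adjoin K {h} := by
    rw [show star h = algebraMap K _ (2 * h.re) - h by rw [← hadd]; abel]
    exact sub_mem (Subalgebra.algebraMap_mem _ _) hmem
  let ψ : Algebra.adjoin K {h} →ₐ[ℤ] ℍ[K, A, B] := (Algebra.adjoin K {h}).val.restrictScalars ℤ
  have hψ : Function.Injective ψ := Subtype.val_injective
  have h1 : IsIntegral ℤ (⟨h, hmem⟩ : Algebra.adjoin K {h}) := (isIntegral_algHom_iff ψ hψ).1 hh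
  have h2 : IsIntegral ℤ (⟨star h, hmem'⟩ : Algebra.adjoin K {h}) :=
    (isIntegral_algHom_iff ψ hψ).1 hstar
  have hinj : Function.Injective (algebraMap K ℍ[K, A, B]) := (algebraMap K _).injective
  constructor
  · have := (h1.add h2).map ψ
    rw [map_add] at this
    exact (isIntegral_algebraMap_iff hinj).1 (hadd ▸ this)
  · have := (h1.mul h2).map ψ
    rw [map_mul] at this
    exact (isIntegral_algebraMap_iff hinj).1 (hmul ▸ this)

end Integrality

section Orders

variable {F : Type} [Field F] (ε : 𝓞 F)

/-- The inclusion of the order `O_F[i, j]` in the quaternion algebra. -/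
def intEmbedding : ℍ[𝓞 F, -1, -ε] →+* ℍ[F, -1, -(algebraMap (𝓞 F) F ε)] where
  toFun x := ⟨algebraMap _ _ x.re, algebraMap _ _ x.imI, algebraMap _ _ x.imJ,
    algebraMap _ _ x.imK⟩
  map_one' := by ext <;> simp
  map_zero' := by ext <;> simp
  map_add' x y := by ext <;> simp
  map_mul' x y := by ext <;> simp

variable {ε}

lemma intEmbedding_injective : Function.Injective (intEmbedding ε) := fun x y h => by
  have hinj := FaithfulSMul.algebraMap_injective (𝓞 F) F
  rw [QuaternionAlgebra.ext_iff] at h ⊢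
  exact ⟨hinj h.1, hinj h.2.1, hinj h.2.2.1, hinj h.2.2.2⟩

lemma closure_eq_range :
    Subring.closure (scalarSet F ℍ[F, -1, -(algebraMap (𝓞 F) F ε)] ∪
      {⟨0, 1, 0, 0⟩, ⟨0, 0, 1, 0⟩}) = (intEmbedding ε).range := by
  refine le_antisymm (Subring.closure_le.2 ?_) ?_
  · rintro x (⟨r, rfl⟩ | rfl | rfl)
    · refine ⟨⟨r, 0, 0, 0⟩, ?_⟩
      simp only [QuaternionAlgebra.coe_algebraMap]
      ext <;> simp [intEmbedding]
    · exact ⟨⟨0, 1, 0, 0⟩, by ext <;> simp [intEmbedding]⟩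
    · exact ⟨⟨0, 0, 1, 0⟩, by ext <;> simp [intEmbedding]⟩
  · rintro _ ⟨x, rfl⟩
    set C := Subring.closure (scalarSet F ℍ[F, -1, -(algebraMap (𝓞 F) F ε)] ∪
      {⟨0, 1, 0, 0⟩, ⟨0, 0, 1, 0⟩})
    have hs : ∀ r : 𝓞 F, algebraMap F _ (algebraMap (𝓞 F) F r) ∈ C := fun r =>
      Subring.subset_closure (Or.inl ⟨r, rfl⟩)
    have hi : ⟨0, 1, 0, 0⟩ ∈ C := Subring.subset_closure (Or.inr (Or.inl rfl))
    have hj : ⟨0, 0, 1, 0⟩ ∈ C := Subring.subset_closure (Or.inr (Or.inr rfl))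
    have := C.add_mem (C.add_mem (C.add_mem (hs x.re) (C.mul_mem (hs x.imI) hi))
      (C.mul_mem (hs x.imJ) hj)) (C.mul_mem (hs x.imK) (C.mul_mem hi hj))
    convert this using 1
    simp only [QuaternionAlgebra.coe_algebraMap]
    ext <;> simp [intEmbedding]

/-- Every element of an order containing `O_F[i, j]` has half-integral coordinates. -/
lemma exists_intEmbedding_eq_add_self {ε : (𝓞 F)ˣ}
    {O : Subring ℍ[F, -1, -(algebraMap (𝓞 F) F ε)]} (hO : IsOrder F O)
    (hle : (intEmbedding (ε : 𝓞 F)).range ≤ O) {h : ℍ[F, -1, -(algebraMap (𝓞 F) F ε)]}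
    (hh : h ∈ O) : ∃ x : ℍ[𝓞 F, -1, -(ε : 𝓞 F)], intEmbedding _ x = h + h ∧ 4 ∣ quatNorm x := by
  have h_int : ∀ h ∈ O, IsIntegral ℤ h := fun h hh =>
    IsIntegral.of_mem_of_fg (subalgebraOfSubring O)
      ((Submodule.fg_iff_addSubgroup_fg (AddSubgroup.toIntSubmodule O.toAddSubgroup)).2 hO.2.1)
      h hh
  have htr : ∀ h ∈ O, ∃ r : 𝓞 F, algebraMap (𝓞 F) F r = 2 * h.re := fun h hh =>
    ⟨⟨_, (isIntegral_trace_norm (h_int h hh)).1⟩, rfl⟩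
  have hmul : ∀ x : ℍ[𝓞 F, -1, -(ε : 𝓞 F)], ∃ r : 𝓞 F,
      algebraMap (𝓞 F) F r = 2 * (h * intEmbedding _ x).re := fun x =>
    htr _ (O.mul_mem hh (hle ⟨x, rfl⟩))
  obtain ⟨η, hεη⟩ : ∃ η : 𝓞 F, (ε : 𝓞 F) * η = 1 := ⟨_, ε.mul_inv⟩
  have hη : algebraMap (𝓞 F) F ε * algebraMap (𝓞 F) F η = 1 := by
    rw [← map_mul, hεη, map_one]
  obtain ⟨a, ha⟩ := htr h hh
  obtain ⟨b, hb⟩ := hmul ⟨0, 1, 0, 0⟩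
  obtain ⟨c, hc⟩ := hmul ⟨0, 0, 1, 0⟩
  obtain ⟨d, hd⟩ := hmul ⟨0, 0, 0, 1⟩
  obtain ⟨n, hn⟩ : ∃ r : 𝓞 F, algebraMap (𝓞 F) F r = (h * star h).re :=
    ⟨⟨_, (isIntegral_trace_norm (h_int h hh)).2⟩, rfl⟩
  simp [intEmbedding] at hb hc hd hn
  have kb : algebraMap (𝓞 F) F (-b) = h.imI + h.imI := by
    rw [map_neg]
    linear_combination -hb
  have kc : algebraMap (𝓞 F) F (-(c * η)) = h.imJ + h.imJ := by
    rw [map_neg, map_mul]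
    linear_combination -algebraMap (𝓞 F) F η * hc + 2 * h.imJ * hη
  have kd : algebraMap (𝓞 F) F (-(d * η)) = h.imK + h.imK := by
    rw [map_neg, map_mul]
    linear_combination -algebraMap (𝓞 F) F η * hd + 2 * h.imK * hη
  refine ⟨⟨a, -b, -(c * η), -(d * η)⟩, ?_, n, FaithfulSMul.algebraMap_injective (𝓞 F) F ?_⟩
  · ext
    · exact ha.trans (two_mul _)
    · exact kb
    · exact kc
    · exact kd
  · simp only [quatNorm, map_add, map_mul, map_pow, ha, kb, kc, kd, hn, map_ofNat]
    ring

variable [NumberField F]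

lemma add_self_injective {A B : F} {x y : ℍ[F, A, B]} (h : x + x = y + y) : x = y := by
  rw [← two_nsmul, ← two_nsmul] at h
  have : (2 : F) • x = (2 : F) • y := by simpa [ofNat_smul_eq_nsmul] using h
  exact smul_right_injective _ two_ne_zero this

/-- The order `½ L` attached to a half-order `L`. -/
def halfOrder {L : AddSubgroup ℍ[𝓞 F, -1, -ε]} (hL : IsHalfOrder L) :
    Subring ℍ[F, -1, -(algebraMap (𝓞 F) F ε)] where
  carrier := {h | ∃ x ∈ L, intEmbedding ε x = h + h}
  zero_mem' := ⟨0, L.zero_mem, by simp⟩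
  one_mem' := ⟨1 + 1, hL.two_mem 1, by simp⟩
  add_mem' := by
    rintro a b ⟨x, hx, hxa⟩ ⟨y, hy, hyb⟩
    exact ⟨x + y, L.add_mem hx hy, by rw [map_add, hxa, hyb]; abel⟩
  neg_mem' := by
    rintro a ⟨x, hx, hxa⟩
    exact ⟨-x, L.neg_mem hx, by rw [map_neg, hxa]; abel⟩
  mul_mem' := by
    rintro a b ⟨x, hx, hxa⟩ ⟨y, hy, hyb⟩
    obtain ⟨z, hz, hzxy⟩ := hL.mul_mem x hx y hy
    refine ⟨z, hz, add_self_injective ?_⟩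
    rw [← map_add, hzxy, map_mul, hxa, hyb]
    noncomm_ring

lemma exists_add_self {A B : F} (x : ℍ[F, A, B]) : ∃ h, x = h + h :=
  ⟨(2⁻¹ : F) • x, by rw [← add_smul, ← two_mul, mul_inv_cancel₀ two_ne_zero, one_smul]⟩

lemma halfOrder_le_halfOrder {L M : AddSubgroup ℍ[𝓞 F, -1, -ε]} {hL : IsHalfOrder L}
    {hM : IsHalfOrder M} : halfOrder hL ≤ halfOrder hM ↔ L ≤ M := by
  refine ⟨fun h x hx => ?_, fun h a ⟨x, hx, hxa⟩ => ⟨x, h hx, hxa⟩⟩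
  obtain ⟨a, ha⟩ := exists_add_self (intEmbedding ε x)
  obtain ⟨y, hy, hya⟩ := h (show a ∈ halfOrder hL from ⟨x, hx, ha⟩)
  rwa [intEmbedding_injective (ha.trans hya.symm)]

lemma range_le_halfOrder {L : AddSubgroup ℍ[𝓞 F, -1, -ε]} (hL : IsHalfOrder L) :
    (intEmbedding ε).range ≤ halfOrder hL := by
  rintro _ ⟨x, rfl⟩
  exact ⟨x + x, hL.two_mem x, map_add _ _ _⟩

lemma isOrder_halfOrder {L : AddSubgroup ℍ[𝓞 F, -1, -ε]} (hL : IsHalfOrder L) :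
    IsOrder F (halfOrder hL) := by
  have hrange := range_le_halfOrder hL
  refine ⟨?_, ?_, ?_⟩
  · refine subset_trans ?_ hrange
    rw [← closure_eq_range]
    exact subset_trans Set.subset_union_left Subring.subset_closure
  · let f : ℍ[𝓞 F, -1, -ε] →ₗ[ℤ] ℍ[F, -1, -(algebraMap (𝓞 F) F ε)] :=
      (((DistribSMul.toAddMonoidHom _ (2⁻¹ : F)).comp
        (intEmbedding ε).toAddMonoidHom)).toIntLinearMap
    have : Module.Finite ℤ ℍ[𝓞 F, -1, -ε] := Module.Finite.trans (𝓞 F) _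
    have : IsNoetherian ℤ (LinearMap.range f) := inferInstance
    refine (Submodule.fg_iff_addSubgroup_fg (AddSubgroup.toIntSubmodule
      (halfOrder hL).toAddSubgroup)).1 (isNoetherian_submodule.1 this _ ?_)
    rintro a ⟨x, -, hx⟩
    refine ⟨x, ?_⟩
    change (2⁻¹ : F) • intEmbedding ε x = a
    rw [hx, ← two_smul F, inv_smul_smul₀ two_ne_zero]
  · rw [eq_top_iff]
    rintro h -
    have hmem : ∀ x, intEmbedding ε x ∈ Submodule.span F
        ((halfOrder hL : Subring _) : Set ℍ[F, -1, -(algebraMap (𝓞 F) F ε)]) := fun x =>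
      Submodule.subset_span (hrange ⟨x, rfl⟩)
    have := add_mem (add_mem (add_mem
      (Submodule.smul_mem _ h.re (hmem ⟨1, 0, 0, 0⟩))
      (Submodule.smul_mem _ h.imI (hmem ⟨0, 1, 0, 0⟩)))
      (Submodule.smul_mem _ h.imJ (hmem ⟨0, 0, 1, 0⟩)))
      (Submodule.smul_mem _ h.imK (hmem ⟨0, 0, 0, 1⟩))
    convert this using 1
    ext <;> simp [intEmbedding]

end Orders

section Conjugation

variable {R : Type*} [CommRing R] {e : R}

lemma IsHalfOrder.mem_of_dvd {L : AddSubgroup ℍ[R, -1, -e]} (hL : IsHalfOrder L)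
    {x y : ℍ[R, -1, -e]} (hx : x ∈ L) (h1 : 2 ∣ y.re - x.re) (h2 : 2 ∣ y.imI - x.imI)
    (h3 : 2 ∣ y.imJ - x.imJ) (h4 : 2 ∣ y.imK - x.imK) : y ∈ L := by
  obtain ⟨a, ha⟩ := h1
  obtain ⟨b, hb⟩ := h2
  obtain ⟨c, hc⟩ := h3
  obtain ⟨d, hd⟩ := h4
  convert L.add_mem hx (hL.two_mem ⟨a, b, c, d⟩) using 1
  ext
  · simp
    linear_combination ha
  · simp
    linear_combination hb
  · simp
    linear_combination hc
  · simp
    linear_combination hd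

lemma rotate_rotate_mem {L : AddSubgroup ℍ[R, -1, -e]} (hL : IsHalfOrder L)
    {x : ℍ[R, -1, -e]} : rotate (rotate x) ∈ L ↔ x ∈ L := by
  constructor <;> intro hx <;> refine hL.mem_of_dvd hx ?_ ?_ ?_ ?_ <;> simp only [rotate]
  · simp
  · simp
  · exact ⟨x.imJ, by ring⟩
  · exact ⟨x.imK, by ring⟩
  · simp
  · simp
  · exact ⟨-x.imJ, by ring⟩
  · exact ⟨-x.imK, by ring⟩

lemma two_dvd_sub_mul_of_sq_eq_one [IsDomain R] {β : R} (hβ : β ^ 2 = 1) (b : R) :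
    2 ∣ b - β * b := by
  rcases sq_eq_sq_iff_eq_or_eq_neg.1 (hβ.trans (one_pow 2).symm) with rfl | rfl
  · simp
  · exact ⟨b, by ring⟩

/-- Under the given constraints on sums of squares, `±i` are the only square roots of `-1`. -/
lemma eq_of_mul_self_eq_neg_one [IsDomain R] (h2 : (2 : R) ≠ 0) (h0 : ∀ a : R, a ^ 2 ≠ -1)
    (h1 : ∀ b c d : R, b ^ 2 + e * (c ^ 2 + d ^ 2) = 1 → c = 0 ∧ d = 0)
    {y : ℍ[R, -1, -e]} (hy : y * y = -1) :
    ∃ β : R, β ^ 2 = 1 ∧ y = ⟨0, β, 0, 0⟩ := by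
  obtain ⟨a, b, c, d⟩ := y
  simp only [QuaternionAlgebra.ext_iff, QuaternionAlgebra.re_mul, QuaternionAlgebra.imI_mul,
    QuaternionAlgebra.imJ_mul, QuaternionAlgebra.imK_mul, QuaternionAlgebra.re_neg,
    QuaternionAlgebra.imI_neg, QuaternionAlgebra.imJ_neg, QuaternionAlgebra.imK_neg,
    QuaternionAlgebra.re_one, QuaternionAlgebra.imI_one, QuaternionAlgebra.imJ_one,
    QuaternionAlgebra.imK_one] at hy
  obtain ⟨e1, e2, e3, e4⟩ := hy
  have ha : a = 0 := by
    by_contra ha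
    have hz : ∀ {t : R}, 2 * a * t = 0 → t = 0 := fun h =>
      (mul_eq_zero.1 h).resolve_left (mul_ne_zero h2 ha)
    obtain rfl : b = 0 := hz (by linear_combination e2)
    obtain rfl : c = 0 := hz (by linear_combination e3)
    obtain rfl : d = 0 := hz (by linear_combination e4)
    exact h0 a (by linear_combination e1)
  subst ha
  obtain ⟨rfl, rfl⟩ := h1 b c d (by linear_combination -e1)
  exact ⟨b, by linear_combination -e1, rfl⟩

lemma eq_of_anticommute [IsDomain R] (h2 : (2 : R) ≠ 0) (he : e ≠ 0)
    (h1 : ∀ c d : R, c ^ 2 + d ^ 2 = 1 → c = 0 ∨ d = 0)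
    {β : R} (hβ : β ^ 2 = 1) {z : ℍ[R, -1, -e]} (hz : z * z = ⟨-e, 0, 0, 0⟩)
    (hyz : (⟨0, β, 0, 0⟩ : ℍ[R, -1, -e]) * z = -(z * ⟨0, β, 0, 0⟩)) :
    ∃ γ : R, γ ^ 2 = 1 ∧ (z = ⟨0, 0, γ, 0⟩ ∨ z = ⟨0, 0, 0, γ⟩) := by
  obtain ⟨a, b, c, d⟩ := z
  simp only [QuaternionAlgebra.ext_iff, QuaternionAlgebra.re_mul, QuaternionAlgebra.imI_mul,
    QuaternionAlgebra.imJ_mul, QuaternionAlgebra.imK_mul, QuaternionAlgebra.re_neg,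
    QuaternionAlgebra.imI_neg, QuaternionAlgebra.imJ_neg, QuaternionAlgebra.imK_neg] at hz hyz
  obtain ⟨e1, e2, e3, e4⟩ := hz
  obtain ⟨f1, f2, f3, f4⟩ := hyz
  have hβ0 : β ≠ 0 := by
    rintro rfl
    simp at hβ
  have hz : ∀ {t : R}, 2 * β * t = 0 → t = 0 := fun h =>
    (mul_eq_zero.1 h).resolve_left (mul_ne_zero h2 hβ0)
  obtain rfl : b = 0 := hz (by linear_combination -f1)
  obtain rfl : a = 0 := hz (by linear_combination f2)
  have hcd : c ^ 2 + d ^ 2 = 1 := mul_left_cancel₀ he (by linear_combination -e1)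
  rcases h1 c d hcd with rfl | rfl
  · exact ⟨d, by linear_combination hcd, Or.inr rfl⟩
  · exact ⟨c, by linear_combination hcd, Or.inl rfl⟩

end Conjugation

section ConjugationByOneAddI

variable {F : Type} [Field F] {ε : 𝓞 F}

lemma intEmbedding_rotate (x : ℍ[𝓞 F, -1, -ε]) :
    intEmbedding ε (rotate x) = rotate (intEmbedding ε x) := by
  ext <;> simp [intEmbedding, rotate]

lemma rotate_add_self {A : F} (x : ℍ[F, -1, -A]) : rotate (x + x) = rotate x + rotate x := by
  ext <;> simp [rotate]

lemma rotate_rotate_rotate_rotate {A : F} (x : ℍ[F, -1, -A]) :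
    rotate (rotate (rotate (rotate x))) = x := by
  ext <;> simp [rotate]

variable [CharZero F]

/-- The unit `1 + i`. -/
def oneAddI (A : F) : ℍ[F, -1, A]ˣ where
  val := ⟨1, 1, 0, 0⟩
  inv := ⟨2⁻¹, -2⁻¹, 0, 0⟩
  val_inv := by
    ext <;> simp
    linear_combination mul_inv_cancel₀ (two_ne_zero (α := F))
  inv_val := by
    ext <;> simp
    linear_combination mul_inv_cancel₀ (two_ne_zero (α := F))

lemma oneAddI_conj {A : F} (y : ℍ[F, -1, -A]) :
    (oneAddI (-A) : ℍ[F, -1, -A]) * y * ((oneAddI (-A))⁻¹ : ℍ[F, -1, -A]ˣ) = rotate y := by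
  have h2 := mul_inv_cancel₀ (two_ne_zero (α := F))
  ext <;> simp [oneAddI, rotate]
  · linear_combination y.re * h2
  · linear_combination y.imI * h2
  · linear_combination -y.imK * h2
  · linear_combination y.imJ * h2

lemma isConjugate_oneAddI_of_forall {A : F} {O O' : Subring ℍ[F, -1, -A]}
    (h : ∀ y ∈ O, rotate y ∈ O') (h' : ∀ y ∈ O', rotate (rotate (rotate y)) ∈ O) :
    IsConjugate (oneAddI (-A)) O O' := by
  intro y
  rw [oneAddI_conj]
  refine ⟨h y, fun hy => ?_⟩
  rw [← rotate_rotate_rotate_rotate y]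
  exact h' _ hy

end ConjugationByOneAddI

lemma conj_mul_conj {H : Type*} [Ring H] (x : Hˣ) (y z : H) :
    (x : H) * y * (x⁻¹ : Hˣ) * (x * z * (x⁻¹ : Hˣ)) = x * (y * z) * (x⁻¹ : Hˣ) := by
  simp only [mul_assoc, Units.inv_mul_cancel_left]

section Counting

variable {F : Type} [Field F] [NumberField F] {ε : (𝓞 F)ˣ} {ι κ : Type*}
  {L : ι → AddSubgroup ℍ[𝓞 F, -1, -(ε : 𝓞 F)]} {τ : ι → ι}

lemma exists_le_halfOrder (hL : IsClassification L τ)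
    {O : Subring ℍ[F, -1, -(algebraMap (𝓞 F) F ε)]} (hO : IsOrder F O)
    (hle : (intEmbedding (ε : 𝓞 F)).range ≤ O) : ∃ t, O ≤ halfOrder (hL.isHalfOrder t) := by
  let S : AddSubgroup ℍ[𝓞 F, -1, -(ε : 𝓞 F)] :=
    { carrier := {x | ∃ h ∈ O, intEmbedding (ε : 𝓞 F) x = h + h}
      zero_mem' := ⟨0, O.zero_mem, by simp⟩
      add_mem' := by
        rintro x y ⟨a, ha, hxa⟩ ⟨b, hb, hyb⟩
        exact ⟨a + b, O.add_mem ha hb, by rw [map_add, hxa, hyb]; abel⟩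
      neg_mem' := by
        rintro x ⟨a, ha, hxa⟩
        exact ⟨-a, O.neg_mem ha, by rw [map_neg, hxa]; abel⟩ }
  obtain ⟨t, ht⟩ := hL.cover S <| by
    rintro x ⟨h, hh, hx⟩
    obtain ⟨y, hy, hy4⟩ := exists_intEmbedding_eq_add_self hO hle hh
    rwa [intEmbedding_injective (hx.trans hy.symm)]
  refine ⟨t, fun h hh => ?_⟩
  obtain ⟨x, hx, -⟩ := exists_intEmbedding_eq_add_self hO hle hh
  exact ⟨x, ht ⟨h, hh, hx⟩, hx⟩

lemma isMaximalOrder_halfOrder (hL : IsClassification L τ) (t : ι) :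
    IsMaximalOrder F (halfOrder (hL.isHalfOrder t)) := by
  refine ⟨isOrder_halfOrder _, fun O hO hle => le_antisymm ?_ hle⟩
  obtain ⟨s, hs⟩ := exists_le_halfOrder hL hO ((range_le_halfOrder _).trans hle)
  obtain rfl := hL.antichain t s (halfOrder_le_halfOrder.1 (hle.trans hs))
  exact hs

/-- A classification lists the maximal orders containing `O_F[i, j]`. -/
lemma bijective_halfOrder (hL : IsClassification L τ) :
    Function.Bijective (fun t => (⟨halfOrder (hL.isHalfOrder t), isMaximalOrder_halfOrder hL t,
      range_le_halfOrder _⟩ : {O : Subring ℍ[F, -1, -(algebraMap (𝓞 F) F ε)] //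
        IsMaximalOrder F O ∧ (intEmbedding (ε : 𝓞 F)).range ≤ O})) := by
  refine ⟨fun s t h => hL.antichain s t ?_, fun ⟨O, hO, hle⟩ => ?_⟩
  · exact (halfOrder_le_halfOrder (hL := hL.isHalfOrder s) (hM := hL.isHalfOrder t)).1
      (Subtype.ext_iff.1 h).le
  · obtain ⟨t, ht⟩ := exists_le_halfOrder hL hO.1 hle
    exact ⟨t, Subtype.ext (hO.2 _ (isOrder_halfOrder (hL.isHalfOrder t)) ht)⟩

lemma isConjugate_oneAddI_range :
    IsConjugate (oneAddI _) (intEmbedding (ε : 𝓞 F)).range (intEmbedding (ε : 𝓞 F)).range := by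
  have h : ∀ y ∈ (intEmbedding (ε : 𝓞 F)).range, rotate y ∈ (intEmbedding (ε : 𝓞 F)).range := by
    rintro _ ⟨x, rfl⟩
    exact ⟨_, intEmbedding_rotate x⟩
  exact isConjugate_oneAddI_of_forall h fun y hy => h _ (h _ (h _ hy))

lemma isConjugate_oneAddI_halfOrder (hL : IsClassification L τ) (t : ι) :
    IsConjugate (oneAddI _) (halfOrder (hL.isHalfOrder t)) (halfOrder (hL.isHalfOrder (τ t))) := by
  have h : ∀ t, ∀ y ∈ halfOrder (hL.isHalfOrder t), rotate y ∈ halfOrder (hL.isHalfOrder (τ t)) := by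
    rintro t y ⟨x, hx, hxy⟩
    exact ⟨_, hL.rotate_mem t x hx, by rw [intEmbedding_rotate, hxy, rotate_add_self]⟩
  refine isConjugate_oneAddI_of_forall (h t) fun y hy => ?_
  have := h _ _ (h _ _ (h _ _ hy))
  rwa [hL.involutive, hL.involutive] at this

/-- The normalizer of `O_F[i, j]` acts on it, up to signs, by the identity or by `rotate`. -/
lemma exists_conj_eq (h0 : ∀ a : 𝓞 F, a ^ 2 ≠ -1)
    (h1 : ∀ b c d : 𝓞 F, b ^ 2 + ε * (c ^ 2 + d ^ 2) = 1 → c = 0 ∧ d = 0)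
    (h2 : ∀ c d : 𝓞 F, c ^ 2 + d ^ 2 = 1 → c = 0 ∨ d = 0)
    {x : ℍ[F, -1, -(algebraMap (𝓞 F) F ε)]ˣ}
    (hx : IsConjugate x (intEmbedding (ε : 𝓞 F)).range (intEmbedding (ε : 𝓞 F)).range) :
    ∃ β γ : 𝓞 F, β ^ 2 = 1 ∧ γ ^ 2 = 1 ∧
      ((∀ y, (x : ℍ[F, -1, -(algebraMap (𝓞 F) F ε)]) * intEmbedding (ε : 𝓞 F) y *
          (x⁻¹ : ℍ[F, -1, -(algebraMap (𝓞 F) F ε)]ˣ) =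
          intEmbedding (ε : 𝓞 F) ⟨y.re, β * y.imI, γ * y.imJ, β * γ * y.imK⟩) ∨
      (∀ y, (x : ℍ[F, -1, -(algebraMap (𝓞 F) F ε)]) * intEmbedding (ε : 𝓞 F) y *
          (x⁻¹ : ℍ[F, -1, -(algebraMap (𝓞 F) F ε)]ˣ) =
          intEmbedding (ε : 𝓞 F) ⟨y.re, β * y.imI, β * γ * -y.imK, γ * y.imJ⟩)) := by
  choose c hc using fun y => (hx (intEmbedding (ε : 𝓞 F) y)).1 ⟨y, rfl⟩
  have hinj := intEmbedding_injective (ε := (ε : 𝓞 F))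
  have hmul : ∀ y z, c (y * z) = c y * c z := fun y z => hinj <| by
    rw [map_mul, hc, hc, hc, conj_mul_conj, map_mul]
  have hadd : ∀ y z, c (y + z) = c y + c z := fun y z => hinj <| by
    rw [map_add, hc, hc, hc, map_add, mul_add, add_mul]
  have hscal : ∀ r : 𝓞 F, c ⟨r, 0, 0, 0⟩ = ⟨r, 0, 0, 0⟩ := fun r => hinj <| by
    rw [hc]
    have : intEmbedding (ε : 𝓞 F) ⟨r, 0, 0, 0⟩ = algebraMap F _ (algebraMap (𝓞 F) F r) := by
      rw [QuaternionAlgebra.coe_algebraMap]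
      ext <;> simp [intEmbedding]
    rw [this, ← Algebra.commutes, mul_assoc, Units.mul_inv, mul_one]
  have hneg : ∀ y, c (-y) = -c y := fun y => by
    have := hadd y (-y)
    rw [add_neg_cancel, show (0 : ℍ[𝓞 F, -1, -(ε : 𝓞 F)]) = ⟨0, 0, 0, 0⟩ from rfl, hscal] at this
    exact (neg_eq_of_add_eq_zero_right this.symm).symm
  have htwo : (2 : 𝓞 F) ≠ 0 := two_ne_zero
  obtain ⟨β, hβ, hβi⟩ := eq_of_mul_self_eq_neg_one htwo h0 h1 (y := c ⟨0, 1, 0, 0⟩) <| by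
    rw [← hmul, show (-1 : ℍ[𝓞 F, -1, -(ε : 𝓞 F)]) = ⟨-1, 0, 0, 0⟩ by ext <;> simp, ← hscal]
    congr 1
    ext <;> simp
  obtain ⟨γ, hγ, hγj⟩ := eq_of_anticommute htwo ε.ne_zero h2 hβ (z := c ⟨0, 0, 1, 0⟩) (by
    rw [← hmul, ← hscal]
    congr 1
    ext <;> simp) (by
    rw [← hβi, ← hmul, ← hmul, ← hneg]
    congr 1
    ext <;> simp)
  have hdecomp : ∀ y : ℍ[𝓞 F, -1, -(ε : 𝓞 F)], c y = ⟨y.re, 0, 0, 0⟩ +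
      ⟨y.imI, 0, 0, 0⟩ * ⟨0, β, 0, 0⟩ + ⟨y.imJ, 0, 0, 0⟩ * c ⟨0, 0, 1, 0⟩ +
      ⟨y.imK, 0, 0, 0⟩ * (⟨0, β, 0, 0⟩ * c ⟨0, 0, 1, 0⟩) := fun y => by
    rw [← hscal y.re, ← hscal y.imI, ← hscal y.imJ, ← hscal y.imK, ← hβi]
    simp only [← hmul, ← hadd]
    congr 1
    ext <;> simp
  refine ⟨β, γ, hβ, hγ, hγj.imp (fun h y => ?_) fun h y => ?_⟩
  all_goals
    rw [← hc, hdecomp, h]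
    congr 1
    ext <;> simp <;> ring

lemma eq_or_eq_of_isConjugate (hL : IsClassification L τ) (h0 : ∀ a : 𝓞 F, a ^ 2 ≠ -1)
    (h1 : ∀ b c d : 𝓞 F, b ^ 2 + ε * (c ^ 2 + d ^ 2) = 1 → c = 0 ∧ d = 0)
    (h2 : ∀ c d : 𝓞 F, c ^ 2 + d ^ 2 = 1 → c = 0 ∨ d = 0)
    {x : ℍ[F, -1, -(algebraMap (𝓞 F) F ε)]ˣ}
    (hx : IsConjugate x (intEmbedding (ε : 𝓞 F)).range (intEmbedding (ε : 𝓞 F)).range) {s t : ι}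
    (hst : IsConjugate x (halfOrder (hL.isHalfOrder s)) (halfOrder (hL.isHalfOrder t))) :
    s = t ∨ t = τ s := by
  obtain ⟨β, γ, hβ, hγ, h⟩ := exists_conj_eq h0 h1 h2 hx
  have hβγ : (β * γ) ^ 2 = 1 := by rw [mul_pow, hβ, hγ, one_mul]
  have hinj := intEmbedding_injective (ε := (ε : 𝓞 F))
  have hmem : ∀ y ∈ L s, ∃ z ∈ L t, intEmbedding (ε : 𝓞 F) z =
      (x : ℍ[F, -1, -(algebraMap (𝓞 F) F ε)]) * intEmbedding (ε : 𝓞 F) y *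
        (x⁻¹ : ℍ[F, -1, -(algebraMap (𝓞 F) F ε)]ˣ) := fun y hy => by
    obtain ⟨a, ha⟩ := exists_add_self (intEmbedding (ε : 𝓞 F) y)
    obtain ⟨z, hz, hza⟩ := (hst a).1 ⟨y, hy, ha⟩
    exact ⟨z, hz, by rw [hza, ha, mul_add, add_mul]⟩
  rcases h with h | h
  · refine Or.inl (hL.antichain s t fun y hy => ?_)
    obtain ⟨z, hz, hzy⟩ := hmem y hy
    obtain rfl := hinj (hzy.trans (h y))
    exact (hL.isHalfOrder t).mem_of_dvd hz (by simp)
      (two_dvd_sub_mul_of_sq_eq_one hβ _) (two_dvd_sub_mul_of_sq_eq_one hγ _)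
      (two_dvd_sub_mul_of_sq_eq_one hβγ _)
  · have hle : L s ≤ L (τ t) := fun y hy => by
      obtain ⟨z, hz, hzy⟩ := hmem y hy
      obtain rfl := hinj (hzy.trans (h y))
      have hr : rotate y ∈ L t :=
        (hL.isHalfOrder t).mem_of_dvd hz (by simp [rotate])
          (two_dvd_sub_mul_of_sq_eq_one hβ _) (two_dvd_sub_mul_of_sq_eq_one hβγ _)
          (two_dvd_sub_mul_of_sq_eq_one hγ _)
      exact (rotate_rotate_mem (hL.isHalfOrder _)).1 (hL.rotate_mem t _ hr)
    rw [hL.antichain _ _ hle, hL.involutive]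
    exact Or.inr rfl

/-- A classification computes the number of maximal orders containing `O_F[i, j]` and the number
of their orbits under the normalizer. -/
theorem alephNum_bethNum_eq (hL : IsClassification L τ) (h0 : ∀ a : 𝓞 F, a ^ 2 ≠ -1)
    (h1 : ∀ b c d : 𝓞 F, b ^ 2 + ε * (c ^ 2 + d ^ 2) = 1 → c = 0 ∧ d = 0)
    (h2 : ∀ c d : 𝓞 F, c ^ 2 + d ^ 2 = 1 → c = 0 ∨ d = 0) {f : ι → κ}
    (hf : Function.Surjective f) (hfτ : ∀ s t, f s = f t ↔ s = t ∨ t = τ s) :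
    alephNum F (intEmbedding (ε : 𝓞 F)).range = Nat.card ι ∧
      bethNum F (intEmbedding (ε : 𝓞 F)).range = Nat.card κ := by
  refine ⟨(Nat.card_eq_of_bijective _ (bijective_halfOrder hL)).symm, ?_⟩
  let g := Equiv.ofBijective _ (bijective_halfOrder hL)
  have hrel : ∀ s t, (∃ x, IsConjugate x (intEmbedding (ε : 𝓞 F)).range
      (intEmbedding (ε : 𝓞 F)).range ∧ IsConjugate x (g s).1 (g t).1) ↔ f s = f t := by
    intro s t
    rw [hfτ]
    constructor
    · rintro ⟨x, hx, hxst⟩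
      exact eq_or_eq_of_isConjugate hL h0 h1 h2 hx hxst
    · rintro (rfl | rfl)
      · exact ⟨1, fun y => by simp, fun y => by simp⟩
      · exact ⟨_, isConjugate_oneAddI_range, isConjugate_oneAddI_halfOrder hL s⟩
  refine Nat.card_eq_of_bijective (Quot.lift (fun O => f (g.symm O)) fun O O' h => ?_) ⟨?_, ?_⟩
  · rw [← hrel, g.apply_symm_apply, g.apply_symm_apply]
    exact h
  · rintro ⟨O⟩ ⟨O'⟩ h
    change f (g.symm O) = f (g.symm O') at h
    rw [← hrel, g.apply_symm_apply, g.apply_symm_apply] at h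
    exact Quot.sound h
  · intro k
    obtain ⟨t, rfl⟩ := hf k
    exact ⟨Quot.mk _ (g t), congrArg f (g.symm_apply_apply t)⟩

end Counting

section QuadraticField

lemma sq_ne_squarefree {d : ℕ} (hd : 1 < d) (hsf : Squarefree d) (r : ℚ) : r ^ 2 ≠ d := by
  intro h
  obtain ⟨m, rfl⟩ : ∃ m : ℤ, (m : ℚ) = r := by
    have hr : IsIntegral ℤ r := .of_pow two_pos (h ▸ isIntegral_algebraMap (x := (d : ℤ)))
    exact IsIntegrallyClosed.isIntegral_iff.1 hr
  have hm : m.natAbs * m.natAbs = d := by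
    zify
    rw [abs_mul_abs_self, ← sq]
    exact_mod_cast h
  have := Nat.isUnit_iff.1 (hsf m.natAbs ⟨1, by rw [hm, mul_one]⟩)
  rw [this] at hm
  omega

lemma eq_intCast_of_mul_sq {d : ℕ} (hsf : Squarefree d) {r : ℚ} {k : ℤ} (h : d * r ^ 2 = k) :
    ∃ n : ℤ, r = n := by
  have hden : (r.den : ℚ) ≠ 0 := by exact_mod_cast r.den_ne_zero
  have h1 : (d : ℤ) * r.num ^ 2 = k * (r.den : ℤ) ^ 2 := by
    rw [← Rat.num_div_den r] at h
    field_simp at h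
    rw [mul_comm k]
    exact_mod_cast h
  have h2 : (r.den : ℤ) * r.den ∣ d := by
    refine IsCoprime.dvd_of_dvd_mul_right (z := r.num ^ 2) ?_ ⟨k, by rw [h1]; ring⟩
    have : IsCoprime (r.den : ℤ) r.num :=
      (Int.isCoprime_iff_gcd_eq_one.2 (by simpa [Int.gcd] using r.reduced)).symm
    exact (this.mul_left this).pow_right
  have h3 := Nat.isUnit_iff.1 (hsf r.den (by exact_mod_cast h2))
  exact ⟨r.num, (Rat.den_eq_one_iff r |>.1 h3).symm⟩

variable {F : Type} [Field F] [NumberField F] {d : ℕ} {δ : F}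

lemma eq_zero_of_add_mul_eq_zero (hd : 1 < d) (hsf : Squarefree d) (hδ : δ ^ 2 = d) {p q : ℚ}
    (h : (p : F) + q * δ = 0) : p = 0 ∧ q = 0 := by
  by_cases hq : q = 0
  · subst hq
    simpa using h
  · refine absurd ?_ (sq_ne_squarefree hd hsf (p / q))
    have hq' : (q : F) ≠ 0 := by exact_mod_cast hq
    have : ((p / q : ℚ) : F) ^ 2 = d := by
      rw [← hδ, Rat.cast_div, eq_neg_of_add_eq_zero_left h, neg_div, mul_div_cancel_left₀ _ hq',
        neg_sq]
    exact_mod_cast this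

/-- A quadratic field as a quadratic algebra. -/
lemma exists_algEquiv (hd : 1 < d) (hsf : Squarefree d) (hδ : δ ^ 2 = d)
    (hgen : Algebra.adjoin ℚ {δ} = ⊤) :
    ∃ E : QuadraticAlgebra ℚ (d : ℚ) 0 ≃ₐ[ℚ] F, ∀ z, E z = z.re + z.im * δ := by
  let E := QuadraticAlgebra.lift (R := ℚ) (a := (d : ℚ)) (b := 0) (A := F)
    ⟨δ, by rw [← sq, hδ, zero_smul, add_zero, Algebra.smul_def]; simp⟩
  have hE : ∀ z, E z = z.re + z.im * δ := fun z => by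
    simp [E, Algebra.smul_def]
  refine ⟨AlgEquiv.ofBijective E ⟨?_, ?_⟩, hE⟩
  · rw [injective_iff_map_eq_zero]
    intro z hz
    rw [hE] at hz
    obtain ⟨h1, h2⟩ := eq_zero_of_add_mul_eq_zero hd hsf hδ hz
    exact QuadraticAlgebra.ext h1 h2
  · rw [← AlgHom.range_eq_top, eq_top_iff, ← hgen, Algebra.adjoin_le_iff]
    rintro _ rfl
    exact ⟨⟨0, 1⟩, (hE _).trans (by simp)⟩

/-- The conjugation of a quadratic field. -/
lemma exists_conj (hd : 1 < d) (hsf : Squarefree d) (hδ : δ ^ 2 = d)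
    (hgen : Algebra.adjoin ℚ {δ} = ⊤) :
    (∀ x : F, ∃ p q : ℚ, x = p + q * δ) ∧ ∃ c : F →ₐ[ℚ] F, c δ = -δ ∧
      ∀ x, x * c x = (Algebra.norm ℚ x : F) := by
  obtain ⟨E, hE⟩ := exists_algEquiv hd hsf hδ hgen
  have hrep : ∀ x : F, ∃ p q : ℚ, x = p + q * δ := fun x =>
    ⟨_, _, by rw [← hE, E.apply_symm_apply]⟩
  refine ⟨hrep, ?_⟩
  let c := (QuadraticAlgebra.lift (R := ℚ) (a := (d : ℚ)) (b := 0) (A := F)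
    ⟨-δ, by rw [neg_mul_neg, ← sq, hδ, zero_smul, add_zero, Algebra.smul_def]; simp⟩).comp
      (E.symm : F →ₐ[ℚ] QuadraticAlgebra ℚ (d : ℚ) 0)
  have hc : ∀ z, c (E z) = z.re - z.im * δ := fun z => by
    simp [c, Algebra.smul_def, sub_eq_add_neg]
  refine ⟨c, ?_, fun x => ?_⟩
  · rw [show δ = E ⟨0, 1⟩ by rw [hE]; simp, hc, hE]
    simp
  · obtain ⟨z, rfl⟩ := E.surjective x
    have : Algebra.norm ℚ (E z) = z.norm := by
      rw [← Algebra.norm_eq_of_algEquiv E.symm, E.symm_apply_apply, Algebra.norm_apply,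
        ← QuadraticAlgebra.det_toLinearMap_eq_norm]
      rfl
    rw [this, hc, hE, QuadraticAlgebra.norm_def]
    push_cast
    linear_combination -(z.im : F) ^ 2 * hδ

end QuadraticField

lemma exists_ringHom_zmod {R : Type*} [CommRing R] {θ : R} {k t : ℤ}
    (hθ : θ * θ = k + t * θ) (hrep : ∀ x : R, ∃ m n : ℤ, x = m + n * θ)
    (huniq : ∀ m n : ℤ, (m : R) + n * θ = 0 → m = 0 ∧ n = 0) {N : ℕ} {r : ZMod N}
    (hr : r * r = k + t * r) : ∃ φ : R →+* ZMod N, φ θ = r := by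
  let E := QuadraticAlgebra.lift (R := ℤ) (a := k) (b := t) (A := R)
    ⟨θ, by rw [hθ]; simp⟩
  have hE : ∀ z, E z = z.re + z.im * θ := fun z => by simp [E]
  let G := QuadraticAlgebra.lift (R := ℤ) (a := k) (b := t) (A := ZMod N)
    ⟨r, by rw [hr]; simp⟩
  have hbij : Function.Bijective E := by
    refine ⟨(injective_iff_map_eq_zero E).2 fun z hz => ?_, fun x => ?_⟩
    · rw [hE] at hz
      exact QuadraticAlgebra.ext (huniq _ _ hz).1 (huniq _ _ hz).2
    · obtain ⟨m, n, rfl⟩ := hrep x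
      exact ⟨⟨m, n⟩, hE _⟩
  let e := AlgEquiv.ofBijective E hbij
  refine ⟨(G : QuadraticAlgebra ℤ k t →+* ZMod N).comp (e.symm : R →+* QuadraticAlgebra ℤ k t), ?_⟩
  have : e.symm θ = ⟨0, 1⟩ := by
    rw [AlgEquiv.symm_apply_eq]
    exact ((hE _).trans (by simp)).symm
  simp [this, G]

section QuadraticField

variable {F : Type} [Field F] {d : ℕ} {δ : 𝓞 F}

lemma coe_sq_eq (hδ : δ ^ 2 = d) : (algebraMap (𝓞 F) F δ) ^ 2 = d := by
  rw [← map_pow, hδ, map_natCast]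

variable [NumberField F]

lemma eq_zero_of_intCast_add_mul_eq_zero (hd : 1 < d) (hsf : Squarefree d) (hδ : δ ^ 2 = d)
    {m n : ℤ} (h : (m : 𝓞 F) + n * δ = 0) : m = 0 ∧ n = 0 := by
  have := congrArg (algebraMap (𝓞 F) F) h
  have h2 := eq_zero_of_add_mul_eq_zero hd hsf (coe_sq_eq hδ) (p := m) (q := n)
    (by simpa using this)
  exact_mod_cast h2

lemma exists_two_mul_eq (hd : 1 < d) (hsf : Squarefree d) (hδ : δ ^ 2 = d)
    (hgen : Algebra.adjoin ℚ {algebraMap (𝓞 F) F δ} = ⊤) (x : 𝓞 F) :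
    ∃ m n : ℤ, 2 * x = m + n * δ ∧ 4 ∣ m ^ 2 - d * n ^ 2 := by
  obtain ⟨hrep, c, hc, -⟩ := exists_conj hd hsf (coe_sq_eq hδ) hgen
  obtain ⟨p, q, hpq⟩ := hrep (algebraMap (𝓞 F) F x)
  have hcx : c (algebraMap (𝓞 F) F x) = p - q * algebraMap (𝓞 F) F δ := by
    rw [hpq, map_add, map_mul, hc, map_ratCast, map_ratCast]
    ring
  have hx : IsIntegral ℤ (algebraMap (𝓞 F) F x) := x.2
  have hx' : IsIntegral ℤ (c (algebraMap (𝓞 F) F x)) := hx.map (c.restrictScalars ℤ)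
  have hrat : ∀ r : ℚ, IsIntegral ℤ (r : F) → ∃ m : ℤ, (m : ℚ) = r := fun r hr => by
    refine IsIntegrallyClosed.isIntegral_iff.1 ?_
    exact (isIntegral_algebraMap_iff (algebraMap ℚ F).injective).1 (by simpa using hr)
  obtain ⟨m, hm⟩ := hrat (2 * p) <| by
    have : ((2 * p : ℚ) : F) = algebraMap (𝓞 F) F x + c (algebraMap (𝓞 F) F x) := by
      rw [hcx, hpq]
      push_cast
      ring
    rw [this]
    exact hx.add hx'
  obtain ⟨N, hN⟩ := hrat (p ^ 2 - d * q ^ 2) <| by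
    have : ((p ^ 2 - d * q ^ 2 : ℚ) : F) = algebraMap (𝓞 F) F x * c (algebraMap (𝓞 F) F x) := by
      rw [hcx, hpq]
      push_cast
      linear_combination (q : F) ^ 2 * coe_sq_eq hδ
    rw [this]
    exact hx.mul hx'
  obtain ⟨n, hn⟩ := eq_intCast_of_mul_sq hsf (r := 2 * q) (k := m ^ 2 - 4 * N) <| by
    push_cast
    rw [hm, hN]
    ring
  refine ⟨m, n, FaithfulSMul.algebraMap_injective (𝓞 F) F ?_, N, ?_⟩
  · simp only [map_mul, map_add, map_intCast, map_ofNat, hpq]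
    have hm' : (m : F) = 2 * p := by exact_mod_cast congrArg (Rat.cast : ℚ → F) hm
    have hn' : (n : F) = 2 * q := by exact_mod_cast congrArg (Rat.cast : ℚ → F) hn.symm
    rw [hm', hn']
    ring
  · have : (m : ℚ) ^ 2 - d * n ^ 2 = 4 * N := by
      rw [hm, ← hn, hN]
      ring
    exact_mod_cast this

lemma exists_eq_add_mul_sqrt (hd : 1 < d) (hsf : Squarefree d) (hδ : δ ^ 2 = d)
    (hgen : Algebra.adjoin ℚ {algebraMap (𝓞 F) F δ} = ⊤) (hd4 : d % 4 = 2 ∨ d % 4 = 3)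
    (x : 𝓞 F) : ∃ m n : ℤ, x = m + n * δ := by
  obtain ⟨m, n, h, h4⟩ := exists_two_mul_eq hd hsf hδ hgen x
  have key : 2 ∣ m ∧ 2 ∣ n := by
    have h4' : (m ^ 2 - d * n ^ 2) % 4 = 0 := Int.emod_eq_zero_of_dvd h4
    have hd' : (d : ℤ) % 4 = 2 ∨ (d : ℤ) % 4 = 3 := by omega
    have hm : m % 4 = 0 ∨ m % 4 = 1 ∨ m % 4 = 2 ∨ m % 4 = 3 := by omega
    have hn : n % 4 = 0 ∨ n % 4 = 1 ∨ n % 4 = 2 ∨ n % 4 = 3 := by omega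
    rcases hd' with h | h <;> rcases hm with h' | h' | h' | h' <;>
      rcases hn with h'' | h'' | h'' | h'' <;>
      simp [pow_two, Int.sub_emod, Int.mul_emod, h, h', h''] at h4' <;> omega
  obtain ⟨⟨m, rfl⟩, ⟨n, rfl⟩⟩ := key
  refine ⟨m, n, mul_left_cancel₀ two_ne_zero (h.trans ?_)⟩
  push_cast
  ring

lemma exists_eq_add_mul_half (hd : 1 < d) (hsf : Squarefree d) (hδ : δ ^ 2 = d)
    (hgen : Algebra.adjoin ℚ {algebraMap (𝓞 F) F δ} = ⊤) {k : ℕ} (hk : d = 4 * k + 1) :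
    ∃ ω : 𝓞 F, δ = 2 * ω - 1 ∧ ω ^ 2 = k + ω ∧ (∀ x : 𝓞 F, ∃ m n : ℤ, x = m + n * ω) ∧
      ∀ m n : ℤ, (m : 𝓞 F) + n * ω = 0 → m = 0 ∧ n = 0 := by
  have hsq := coe_sq_eq hδ
  set D := algebraMap (𝓞 F) F δ with hD
  have hk' : (d : F) = 4 * k + 1 := by exact_mod_cast congrArg (Nat.cast : ℕ → F) hk
  have h_int : IsIntegral ℤ ((1 + D) / 2) := by
    refine ⟨Polynomial.X ^ 2 - Polynomial.X - Polynomial.C (k : ℤ), by monicity!, ?_⟩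
    simp
    linear_combination (1 / 4) * (hsq.trans hk')
  obtain ⟨ω, hω⟩ : ∃ ω : 𝓞 F, algebraMap (𝓞 F) F ω = (1 + D) / 2 := ⟨⟨_, h_int⟩, rfl⟩
  have hinj := FaithfulSMul.algebraMap_injective (𝓞 F) F
  have h1 : δ = 2 * ω - 1 := hinj <| by
    simp only [map_sub, map_mul, map_one, map_ofNat, hω, ← hD]
    ring
  refine ⟨ω, h1, hinj ?_, fun x => ?_, fun m n h => ?_⟩
  · simp only [map_pow, map_add, map_natCast, hω]
    linear_combination (1 / 4) * (hsq.trans hk')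
  · obtain ⟨m, n, h, h4⟩ := exists_two_mul_eq hd hsf hδ hgen x
    obtain ⟨l, hl⟩ : 2 ∣ m - n := by
      have h2 : 2 ∣ m ^ 2 - d * n ^ 2 := dvd_trans (by norm_num) h4
      have hd2 : (d : ℤ) = 4 * k + 1 := by exact_mod_cast hk
      have h3 : 2 ∣ (m - n) ^ 2 := by
        have : (m - n) ^ 2 = (m ^ 2 - d * n ^ 2) + 2 * (n ^ 2 - m * n + 2 * k * n ^ 2) := by
          rw [hd2]
          ring
        rw [this]
        exact dvd_add h2 (dvd_mul_right _ _)
      exact Int.prime_two.dvd_of_dvd_pow h3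
    obtain rfl : m = n + 2 * l := by linear_combination hl
    refine ⟨l, n, mul_left_cancel₀ two_ne_zero (h.trans ?_)⟩
    rw [h1]
    push_cast
    ring
  · have := eq_zero_of_intCast_add_mul_eq_zero hd hsf hδ (m := 2 * m + n) (n := n) <| by
      rw [h1]
      push_cast
      linear_combination 2 * h
    omega

end QuadraticField

section QuadraticField

variable {F : Type} [Field F] [NumberField F] {d : ℕ} {δ : 𝓞 F}

lemma sq_sub_mul_sq_eq (hd : 1 < d) (hsf : Squarefree d) (hδ : δ ^ 2 = d)
    (hgen : Algebra.adjoin ℚ {algebraMap (𝓞 F) F δ} = ⊤) {ε : 𝓞 F}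
    (hε : Algebra.norm ℚ (algebraMap (𝓞 F) F ε) = 1) {l m n : ℤ} (h : l * ε = m + n * δ) :
    m ^ 2 - d * n ^ 2 = l ^ 2 := by
  obtain ⟨-, c, hc, hcn⟩ := exists_conj hd hsf (coe_sq_eq hδ) hgen
  have h1 : (l : F) * algebraMap (𝓞 F) F ε = m + n * algebraMap (𝓞 F) F δ := by
    simpa using congrArg (algebraMap (𝓞 F) F) h
  have h2 := congrArg c h1
  simp only [map_mul, map_add, map_intCast, hc] at h2
  have h3 := hcn (algebraMap (𝓞 F) F ε)
  rw [hε, Rat.cast_one] at h3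
  have : (m : F) ^ 2 - d * n ^ 2 = l ^ 2 := by
    rw [← coe_sq_eq hδ]
    linear_combination (l : F) ^ 2 * h3 - l * c (algebraMap (𝓞 F) F ε) * h1 -
      (m + n * algebraMap (𝓞 F) F δ) * h2
  exact_mod_cast this

/-- The two real embeddings of a real quadratic field. -/
lemma exists_embedding (hd : 1 < d) (hsf : Squarefree d) (hδ : δ ^ 2 = d)
    (hgen : Algebra.adjoin ℚ {algebraMap (𝓞 F) F δ} = ⊤) (σ₀ : F →+* ℝ) :
    ∃ σ₁ : F →+* ℝ, ∀ x : F, σ₀ x * σ₁ x = (Algebra.norm ℚ x : ℝ) := by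
  obtain ⟨-, c, -, hcn⟩ := exists_conj hd hsf (coe_sq_eq hδ) hgen
  exact ⟨σ₀.comp c, fun x => by rw [RingHom.comp_apply, ← map_mul, RingHom.coe_coe, hcn,
    map_ratCast]⟩

lemma one_le_norm_sq {c : 𝓞 F} (hc : c ≠ 0) : 1 ≤ Algebra.norm ℚ (algebraMap (𝓞 F) F c) ^ 2 := by
  have h0 : Algebra.norm ℤ c ≠ 0 := Algebra.norm_ne_zero_iff.2 hc
  rw [← Algebra.coe_norm_int]
  exact_mod_cast Int.one_le_abs (pow_ne_zero 2 h0) |>.trans_eq (abs_of_nonneg (sq_nonneg _))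

lemma sq_add_sq_eq_one (hd : 1 < d) (hsf : Squarefree d) (hδ : δ ^ 2 = d)
    (hgen : Algebra.adjoin ℚ {algebraMap (𝓞 F) F δ} = ⊤) (σ₀ : F →+* ℝ) {b c : 𝓞 F}
    (h : b ^ 2 + c ^ 2 = 1) : b = 0 ∨ c = 0 := by
  obtain ⟨σ₁, hσ⟩ := exists_embedding hd hsf hδ hgen σ₀
  by_contra! hbc
  have hb : (1 : ℝ) ≤ (σ₀ (algebraMap (𝓞 F) F b) * σ₁ (algebraMap (𝓞 F) F b)) ^ 2 := by
    rw [hσ]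
    exact_mod_cast one_le_norm_sq hbc.1
  have hpos : ∀ σ : F →+* ℝ, 0 < σ (algebraMap (𝓞 F) F c) ^ 2 := fun σ => by
    have : σ (algebraMap (𝓞 F) F c) ≠ 0 := by
      simpa using hbc.2
    positivity
  have hsum : ∀ σ : F →+* ℝ,
      σ (algebraMap (𝓞 F) F b) ^ 2 + σ (algebraMap (𝓞 F) F c) ^ 2 = 1 := fun σ => by
    simpa using congrArg (fun t => σ (algebraMap (𝓞 F) F t)) h
  have h0 := hsum σ₀
  have h1 := hsum σ₁
  have h2 := hpos σ₀
  have h3 := hpos σ₁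
  rw [mul_pow] at hb
  nlinarith [sq_nonneg (σ₀ (algebraMap (𝓞 F) F b)), sq_nonneg (σ₁ (algebraMap (𝓞 F) F b))]

/-- The fundamental unit has no multiple by a nonzero square which is at most `1` under both
embeddings. -/
lemma eq_zero_of_mul_sq_le_one {ε : (𝓞 F)ˣ} {σ₀ σ₁ : F →+* ℝ}
    (hσ : ∀ x : F, σ₀ x * σ₁ x = (Algebra.norm ℚ x : ℝ))
    (hε : 1 < σ₀ (algebraMap (𝓞 F) F ε))
    (hfund : ∀ u : (𝓞 F)ˣ, 1 < σ₀ (algebraMap (𝓞 F) F u) →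
      σ₀ (algebraMap (𝓞 F) F ε) ≤ σ₀ (algebraMap (𝓞 F) F u))
    (hnorm : Algebra.norm ℚ (algebraMap (𝓞 F) F ε) = 1) {c : 𝓞 F}
    (h0 : σ₀ (algebraMap (𝓞 F) F (ε * c ^ 2)) ≤ 1)
    (h1 : σ₁ (algebraMap (𝓞 F) F (ε * c ^ 2)) ≤ 1) : c = 0 := by
  by_contra hc
  have hc1 : (1 : ℝ) ≤ (σ₀ (algebraMap (𝓞 F) F c) * σ₁ (algebraMap (𝓞 F) F c)) ^ 2 := by
    rw [hσ]
    exact_mod_cast one_le_norm_sq hc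
  have hε1 : σ₀ (algebraMap (𝓞 F) F ε) * σ₁ (algebraMap (𝓞 F) F ε) = 1 := by
    rw [hσ, hnorm, Rat.cast_one]
  have hprod : 1 ≤ σ₀ (algebraMap (𝓞 F) F (ε * c ^ 2)) * σ₁ (algebraMap (𝓞 F) F (ε * c ^ 2)) := by
    simp only [map_mul, map_pow]
    refine hc1.trans_eq ?_
    linear_combination -(σ₀ (algebraMap (𝓞 F) F c) * σ₁ (algebraMap (𝓞 F) F c)) ^ 2 * hε1
  have hpos : 0 ≤ σ₀ (algebraMap (𝓞 F) F (ε * c ^ 2)) := by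
    simp only [map_mul, map_pow]
    positivity
  have heq : σ₀ (algebraMap (𝓞 F) F (ε * c ^ 2)) = 1 :=
    le_antisymm h0 (hprod.trans (mul_le_of_le_one_right hpos h1))
  have hunit : (ε : 𝓞 F) * c ^ 2 = 1 := by
    apply FaithfulSMul.algebraMap_injective (𝓞 F) F
    apply σ₀.injective
    rw [heq, map_one, map_one]
  have key : ∀ u : (𝓞 F)ˣ, (u : 𝓞 F) ^ 2 = ε → ¬ 0 < σ₀ (algebraMap (𝓞 F) F u) := by
    intro u hu hu0
    have hsq : σ₀ (algebraMap (𝓞 F) F u) ^ 2 = σ₀ (algebraMap (𝓞 F) F ε) := by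
      rw [← hu, map_pow, map_pow]
    have hu1 : 1 < σ₀ (algebraMap (𝓞 F) F u) := by nlinarith
    nlinarith [hfund u hu1]
  obtain ⟨u, hu⟩ : ∃ u : (𝓞 F)ˣ, (u : 𝓞 F) = ε * c :=
    ⟨⟨ε * c, c, by linear_combination hunit, by linear_combination hunit⟩, rfl⟩
  have husq : (u : 𝓞 F) ^ 2 = ε := by
    rw [hu]
    linear_combination (ε : 𝓞 F) * hunit
  have hne : σ₀ (algebraMap (𝓞 F) F u) ≠ 0 := by simp
  rcases hne.lt_or_gt with h | h
  · exact key (-u) (by simpa using husq) (by simpa using h)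
  · exact key u husq h

lemma sq_add_mul_eq_one (hd : 1 < d) (hsf : Squarefree d) (hδ : δ ^ 2 = d)
    (hgen : Algebra.adjoin ℚ {algebraMap (𝓞 F) F δ} = ⊤) {ε : (𝓞 F)ˣ} {σ₀ : F →+* ℝ}
    (hε : 1 < σ₀ (algebraMap (𝓞 F) F ε))
    (hfund : ∀ u : (𝓞 F)ˣ, 1 < σ₀ (algebraMap (𝓞 F) F u) →
      σ₀ (algebraMap (𝓞 F) F ε) ≤ σ₀ (algebraMap (𝓞 F) F u))
    (hnorm : Algebra.norm ℚ (algebraMap (𝓞 F) F ε) = 1) {a b c : 𝓞 F}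
    (h : a ^ 2 + ε * (b ^ 2 + c ^ 2) = 1) : b = 0 ∧ c = 0 := by
  obtain ⟨σ₁, hσ⟩ := exists_embedding hd hsf hδ hgen σ₀
  have hε1 : σ₀ (algebraMap (𝓞 F) F ε) * σ₁ (algebraMap (𝓞 F) F ε) = 1 := by
    rw [hσ, hnorm, Rat.cast_one]
  have hpos0 : 0 < σ₀ (algebraMap (𝓞 F) F ε) := by linarith
  have hpos1 : 0 < σ₁ (algebraMap (𝓞 F) F ε) := by
    by_contra! hneg
    nlinarith
  have hle : ∀ σ : F →+* ℝ, 0 < σ (algebraMap (𝓞 F) F ε) →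
      σ (algebraMap (𝓞 F) F (ε * b ^ 2)) ≤ 1 ∧ σ (algebraMap (𝓞 F) F (ε * c ^ 2)) ≤ 1 := by
    intro σ hσpos
    have hsum := congrArg (fun t => σ (algebraMap (𝓞 F) F t)) h
    simp only [map_add, map_mul, map_pow, map_one] at hsum ⊢
    constructor <;> nlinarith [mul_nonneg hσpos.le (sq_nonneg (σ (algebraMap (𝓞 F) F b))),
      mul_nonneg hσpos.le (sq_nonneg (σ (algebraMap (𝓞 F) F c))),
      sq_nonneg (σ (algebraMap (𝓞 F) F a))]
  exact ⟨eq_zero_of_mul_sq_le_one hσ hε hfund hnorm (hle σ₀ hpos0).1 (hle σ₁ hpos1).1,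
    eq_zero_of_mul_sq_le_one hσ hε hfund hnorm (hle σ₀ hpos0).2 (hle σ₁ hpos1).2⟩

lemma sq_ne_neg_one (σ₀ : F →+* ℝ) (a : 𝓞 F) : a ^ 2 ≠ -1 := by
  intro h
  have := congrArg (fun t => σ₀ (algebraMap (𝓞 F) F t)) h
  simp only [map_pow, map_neg, map_one] at this
  nlinarith [sq_nonneg (σ₀ (algebraMap (𝓞 F) F a))]

end QuadraticField

section QuadraticRing

variable {R : Type*} [CommRing R]

lemma two_dvd_add_mul_iff {θ : R} (hrep : ∀ x : R, ∃ m n : ℤ, x = m + n * θ)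
    (huniq : ∀ m n : ℤ, (m : R) + n * θ = 0 → m = 0 ∧ n = 0) {m n : ℤ} :
    (2 : R) ∣ m + n * θ ↔ 2 ∣ m ∧ 2 ∣ n := by
  constructor
  · rintro ⟨y, hy⟩
    obtain ⟨a, b, rfl⟩ := hrep y
    obtain ⟨h1, h2⟩ := huniq (m - 2 * a) (n - 2 * b) <| by
      push_cast
      linear_combination hy
    exact ⟨⟨a, by omega⟩, ⟨b, by omega⟩⟩
  · rintro ⟨⟨a, rfl⟩, ⟨b, rfl⟩⟩
    exact ⟨a + b * θ, by push_cast; ring⟩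

lemma intCast_zmod_two_eq_zero_iff {m : ℤ} : (m : ZMod 2) = 0 ↔ 2 ∣ m :=
  ZMod.intCast_zmod_eq_zero_iff_dvd m 2

/-- If `2` splits, divisibility by `2` is detected by two homomorphisms to `ZMod 2`. -/
lemma exists_split_ringHom {ω : R} {k : ℤ} (hω : ω ^ 2 = (2 * k : ℤ) + ω)
    (hrep : ∀ x : R, ∃ m n : ℤ, x = m + n * ω)
    (huniq : ∀ m n : ℤ, (m : R) + n * ω = 0 → m = 0 ∧ n = 0) :
    ∃ φ ψ : R →+* ZMod 2, (∀ x, 2 ∣ x ↔ φ x = 0 ∧ ψ x = 0) ∧ φ ω = 0 ∧ ψ ω = 1 := by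
  have hω' : ω * ω = (2 * k : ℤ) + (1 : ℤ) * ω := by
    rw [← sq, hω, Int.cast_one, one_mul]
  have h2 : ((2 * k : ℤ) : ZMod 2) = 0 := intCast_zmod_two_eq_zero_iff.2 (dvd_mul_right 2 k)
  obtain ⟨φ, hφ⟩ := exists_ringHom_zmod hω' hrep huniq (N := 2) (r := 0) (by rw [h2]; simp)
  obtain ⟨ψ, hψ⟩ := exists_ringHom_zmod hω' hrep huniq (N := 2) (r := 1) (by rw [h2]; simp)
  refine ⟨φ, ψ, fun x => ?_, hφ, hψ⟩
  obtain ⟨m, n, rfl⟩ := hrep x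
  simp only [two_dvd_add_mul_iff hrep huniq, map_add, map_mul, map_intCast, hφ, hψ, mul_zero,
    add_zero, mul_one, ← intCast_zmod_two_eq_zero_iff]
  constructor
  · rintro ⟨h, h'⟩
    simp [h, h']
  · rintro ⟨h, h'⟩
    exact ⟨h, by simpa [h] using h'⟩

/-- If `2` is inert, it is prime. -/
lemma two_dvd_or_of_inert {ω : R} {k : ℤ} (hω : ω ^ 2 = (2 * k + 1 : ℤ) + ω)
    (hrep : ∀ x : R, ∃ m n : ℤ, x = m + n * ω)
    (huniq : ∀ m n : ℤ, (m : R) + n * ω = 0 → m = 0 ∧ n = 0) (x y : R) (h : 2 ∣ x * y) :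
    2 ∣ x ∨ 2 ∣ y := by
  obtain ⟨a, b, rfl⟩ := hrep x
  obtain ⟨m, n, rfl⟩ := hrep y
  have h1 : ((a : R) + b * ω) * (m + n * ω) =
      ((a * m + b * n * (2 * k + 1) : ℤ) : R) + ((a * n + b * m + b * n : ℤ) : R) * ω := by
    push_cast at hω ⊢
    linear_combination (b : R) * n * hω
  rw [h1, two_dvd_add_mul_iff hrep huniq] at h
  rw [two_dvd_add_mul_iff hrep huniq, two_dvd_add_mul_iff hrep huniq]
  simp only [← intCast_zmod_two_eq_zero_iff] at h ⊢
  have h2 : (2 : ZMod 2) = 0 := rfl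
  push_cast at h
  rw [h2, zero_mul, zero_add, mul_one] at h
  generalize (a : ZMod 2) = a', (b : ZMod 2) = b', (m : ZMod 2) = m', (n : ZMod 2) = n' at h
  revert a' b' m' n'
  decide

variable {d : ℕ} {δ : R}

lemma exists_isRamified_two (hδ : δ ^ 2 = d) (hd : d % 4 = 2)
    (hrep : ∀ x : R, ∃ m n : ℤ, x = m + n * δ)
    (huniq : ∀ m n : ℤ, (m : R) + n * δ = 0 → m = 0 ∧ n = 0) :
    ∃ φ : R →+* ZMod 2, φ δ = 0 ∧ IsRamified φ δ (d / 2 : ℕ) := by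
  have hd2 : d = 2 * (d / 2) := by omega
  have hz : ((d : ℤ) : ZMod 2) = 0 := intCast_zmod_two_eq_zero_iff.2 (by omega)
  obtain ⟨φ, hφ⟩ := exists_ringHom_zmod (k := d) (t := 0) (by rw [← sq, hδ]; simp) hrep huniq
    (N := 2) (r := 0) (by rw [hz]; simp)
  refine ⟨φ, hφ, ?_, fun x hx => ?_, map_ofNat φ 2, hφ, ?_, fun x hx => ?_⟩
  · rw [hδ]
    exact_mod_cast congrArg (Nat.cast : ℕ → R) hd2
  · obtain ⟨m, n, rfl⟩ := hrep x
    simp only [map_add, map_mul, map_intCast, hφ, mul_zero, add_zero] at hx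
    obtain ⟨l, rfl⟩ := intCast_zmod_two_eq_zero_iff.1 hx
    exact ⟨n, l, by push_cast; ring⟩
  · rw [map_natCast, ← Nat.cast_one, ZMod.natCast_eq_natCast_iff']
    omega
  · obtain ⟨m, n, rfl⟩ := hrep x
    have h1 : δ * (m + n * δ) = ((d * n : ℤ) : R) + m * δ := by
      push_cast
      linear_combination (n : R) * hδ
    rw [h1, two_dvd_add_mul_iff hrep huniq] at hx
    simpa [hφ] using intCast_zmod_two_eq_zero_iff.2 hx.2

lemma exists_isRamified_three (hδ : δ ^ 2 = d) (hd : d % 4 = 3)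
    (hrep : ∀ x : R, ∃ m n : ℤ, x = m + n * δ)
    (huniq : ∀ m n : ℤ, (m : R) + n * δ = 0 → m = 0 ∧ n = 0) :
    ∃ φ : R →+* ZMod 2, φ δ = 1 ∧ IsRamified φ (1 + δ) (2 * ((d + 1) / 4 : ℕ) + δ) := by
  have hd4 : d + 1 = 4 * ((d + 1) / 4) := by omega
  have hd4' : (d : R) + 1 = 4 * ((d + 1) / 4 : ℕ) := by
    exact_mod_cast congrArg (Nat.cast : ℕ → R) hd4
  have hz : ((d : ℤ) : ZMod 2) = 1 := by
    have : ((d : ℤ) : ZMod 2) = ((1 : ℤ) : ZMod 2) := by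
      rw [ZMod.intCast_eq_intCast_iff']
      omega
    simpa using this
  obtain ⟨φ, hφ⟩ := exists_ringHom_zmod (k := d) (t := 0) (by rw [← sq, hδ]; simp) hrep huniq
    (N := 2) (r := 1) (by rw [hz]; simp)
  have h2 : φ 2 = 0 := map_ofNat φ 2
  refine ⟨φ, hφ, ?_, fun x hx => ?_, h2, by rw [map_add, map_one, hφ]; rfl, ?_, fun x hx => ?_⟩
  · linear_combination hδ + hd4'
  · obtain ⟨m, n, rfl⟩ := hrep x
    simp only [map_add, map_mul, map_intCast, hφ, mul_one] at hx
    rw [← Int.cast_add] at hx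
    obtain ⟨l, hl⟩ := intCast_zmod_two_eq_zero_iff.1 hx
    obtain rfl : m = 2 * l - n := by omega
    exact ⟨n, l - n, by push_cast; ring⟩
  · rw [map_add, map_mul, h2, zero_mul, zero_add, hφ]
  · obtain ⟨m, n, rfl⟩ := hrep x
    have h1 : (1 + δ) * (m + n * δ) = ((m + d * n : ℤ) : R) + ((m + n : ℤ) : R) * δ := by
      push_cast
      linear_combination (n : R) * hδ
    rw [h1, two_dvd_add_mul_iff hrep huniq] at hx
    simpa [hφ] using intCast_zmod_two_eq_zero_iff.2 hx.2

end QuadraticRing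

lemma four_dvd_of_sq_sub_mul_sq_eq_one {a b d : ℤ} (ha : a % 2 = 1) (hd : d % 2 = 1)
    (h : a ^ 2 - d * b ^ 2 = 1) : 4 ∣ b := by
  obtain ⟨k, rfl⟩ : ∃ k, a = 2 * k + 1 := ⟨a / 2, by omega⟩
  have hdo : ¬ Even d := by rw [Int.even_iff]; omega
  have hb : Even b := by
    have : Even (d * b ^ 2) := ⟨2 * (k * (k + 1)), by linear_combination -h⟩
    exact (Int.even_pow.1 ((Int.even_mul.1 this).resolve_left hdo)).1
  obtain ⟨c, rfl⟩ := hb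
  have hc : Even c := by
    have : Even (d * c ^ 2) := by
      rw [show d * c ^ 2 = k * (k + 1) by linarith]
      exact Int.even_mul_succ_self k
    exact (Int.even_pow.1 ((Int.even_mul.1 this).resolve_left hdo)).1
  obtain ⟨l, rfl⟩ := hc
  exact ⟨l, by ring⟩

section QuadraticField

variable {F : Type} [Field F] [NumberField F] {d : ℕ} {δ : 𝓞 F} {ε : 𝓞 F} {a b : ℤ}

lemma exists_isClassification_one_mod_eight_of_one (hd : 1 < d) (hsf : Squarefree d)
    (hδ : δ ^ 2 = d) (hgen : Algebra.adjoin ℚ {algebraMap (𝓞 F) F δ} = ⊤)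
    (hd8 : d % 8 = 1) (hε : ε = a + b * δ) (hab : a ^ 2 - d * b ^ 2 = 1) (ha : a % 4 = 1) :
    ∃ L : Unit → AddSubgroup ℍ[𝓞 F, -1, -ε], IsClassification L id := by
  obtain ⟨ω, -, hω, hrep, huniq⟩ := exists_eq_add_mul_half (k := d / 4) hd hsf hδ hgen (by omega)
  obtain ⟨l, hl⟩ : ∃ l : ℕ, d / 4 = 2 * l := ⟨d / 8, by omega⟩
  obtain ⟨φ, ψ, hφψ, -⟩ := exists_split_ringHom (k := l)
    (by rw [hω, hl]; push_cast; ring) hrep huniq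
  obtain ⟨c, rfl⟩ := four_dvd_of_sq_sub_mul_sq_eq_one (by omega) (by omega) hab
  obtain ⟨m, rfl⟩ : ∃ m, a = 4 * m + 1 := ⟨a / 4, by omega⟩
  exact ⟨_, isClassification_split_one hφψ two_ne_zero
    ⟨m + c * δ, by rw [hε]; push_cast; ring⟩⟩

lemma exists_isClassification_one_mod_eight_of_three (hd : 1 < d) (hsf : Squarefree d)
    (hδ : δ ^ 2 = d) (hgen : Algebra.adjoin ℚ {algebraMap (𝓞 F) F δ} = ⊤)
    (hd8 : d % 8 = 1) (hε : ε = a + b * δ) (hab : a ^ 2 - d * b ^ 2 = 1) (ha : a % 4 = 3) :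
    ∃ L : Bool × Bool → AddSubgroup ℍ[𝓞 F, -1, -ε], IsClassification L (Prod.map id not) := by
  obtain ⟨ω, -, hω, hrep, huniq⟩ := exists_eq_add_mul_half (k := d / 4) hd hsf hδ hgen (by omega)
  obtain ⟨l, hl⟩ : ∃ l : ℕ, d / 4 = 2 * l := ⟨d / 8, by omega⟩
  obtain ⟨φ, ψ, hφψ, hφω, hψω⟩ := exists_split_ringHom (k := l)
    (by rw [hω, hl]; push_cast; ring) hrep huniq
  obtain ⟨c, rfl⟩ := four_dvd_of_sq_sub_mul_sq_eq_one (by omega) (by omega) hab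
  obtain ⟨m, rfl⟩ : ∃ m, a = 4 * m - 1 := ⟨a / 4 + 1, by omega⟩
  exact ⟨_, isClassification_split_three hφψ two_ne_zero
    ⟨m + c * δ, by rw [hε]; push_cast; ring⟩ hφω hψω⟩

/-- If `2` is inert, the cube of a unit of norm `1` is `±1` modulo `4`. -/
lemma four_dvd_pow_three_sub_or_add (hd : 1 < d) (hsf : Squarefree d)
    (hδ : δ ^ 2 = d) (hgen : Algebra.adjoin ℚ {algebraMap (𝓞 F) F δ} = ⊤) (hd8 : d % 8 = 5)
    (hε : Algebra.norm ℚ (algebraMap (𝓞 F) F ε) = 1) :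
    4 ∣ ε ^ 3 - 1 ∨ 4 ∣ ε ^ 3 + 1 := by
  obtain ⟨m, n, hmn, -⟩ := exists_two_mul_eq hd hsf hδ hgen ε
  have hn := sq_sub_mul_sq_eq hd hsf hδ hgen hε (l := 2) (by exact_mod_cast hmn)
  rcases Int.even_or_odd' m with ⟨k, rfl | rfl⟩
  · have hne : Even n := by
      have : Even ((d : ℤ) * n ^ 2) := ⟨2 * (k ^ 2 - 1), by linear_combination -hn⟩
      refine (Int.even_pow.1 ((Int.even_mul.1 this).resolve_left ?_)).1
      rw [Int.even_iff]
      omega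
    obtain ⟨l, rfl⟩ := hne
    have hkl : k ^ 2 - (d : ℤ) * l ^ 2 = 1 := by linarith
    have hk : k % 2 = 1 := by
      by_contra hk
      obtain ⟨j, rfl⟩ : ∃ j, k = 2 * j := ⟨k / 2, by omega⟩
      obtain ⟨q, hq⟩ : ∃ q : ℤ, (d : ℤ) = 4 * q + 1 := ⟨d / 4, by omega⟩
      rw [hq] at hkl
      rcases Int.even_or_odd' l with ⟨i, rfl | rfl⟩
      · have : 4 * (j ^ 2 - (4 * q + 1) * i ^ 2) = 1 := by linear_combination hkl
        omega
      · have : 4 * (j ^ 2 - q * (2 * i + 1) ^ 2 - i ^ 2 - i) = 2 := by linear_combination hkl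
        omega
    obtain ⟨c, rfl⟩ := four_dvd_of_sq_sub_mul_sq_eq_one hk (by omega) hkl
    have hεk : ε = k + (4 * c : ℤ) * δ := mul_left_cancel₀ two_ne_zero (by
      rw [hmn]; push_cast; ring)
    push_cast at hεk
    obtain ⟨j, hj⟩ : ∃ j, k = 4 * j + 1 ∨ k = 4 * j - 1 := by
      rcases (by omega : k % 4 = 1 ∨ k % 4 = 3) with h | h
      · exact ⟨k / 4, by omega⟩
      · exact ⟨k / 4 + 1, by omega⟩
    rcases hj with rfl | rfl
    · left
      have h1 : (4 : 𝓞 F) ∣ ε - 1 := ⟨j + c * δ, by rw [hεk]; push_cast; ring⟩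
      have h2 := h1.trans (sub_dvd_pow_sub_pow ε 1 3)
      rwa [one_pow] at h2
    · right
      have h1 : (4 : 𝓞 F) ∣ ε - (-1) := ⟨j + c * δ, by rw [hεk]; push_cast; ring⟩
      have h2 := h1.trans (sub_dvd_pow_sub_pow ε (-1) 3)
      convert h2 using 1
      ring
  · have hn' : ((2 * k + 1 : ℤ) : 𝓞 F) ^ 2 - d * n ^ 2 = 4 := by
      exact_mod_cast congrArg (Int.cast : ℤ → 𝓞 F) hn
    have hsq : ε ^ 2 = (2 * k + 1 : ℤ) * ε - 1 := by
      refine mul_left_cancel₀ (Nat.cast_ne_zero (R := 𝓞 F).2 (four_ne_zero (α := ℕ))) ?_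
      push_cast at hmn hn' ⊢
      linear_combination (2 * ε - (2 * k + 1) + n * δ) * hmn + (n : 𝓞 F) ^ 2 * hδ - hn'
    push_cast at hsq
    have hcube : ε ^ 3 = 4 * (k * (k + 1) * ε) - (2 * k + 1) := by
      linear_combination (ε + 2 * k + 1) * hsq
    rcases Int.even_or_odd' k with ⟨j, rfl | rfl⟩
    · right
      exact ⟨(2 * j : ℤ) * ((2 * j : ℤ) + 1) * ε - j, by rw [hcube]; push_cast; ring⟩
    · left
      exact ⟨(2 * j + 1 : ℤ) * ((2 * j + 1 : ℤ) + 1) * ε - j - 1, by rw [hcube]; push_cast; ring⟩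

lemma exists_isClassification_five_mod_eight (hd : 1 < d) (hsf : Squarefree d)
    (hδ : δ ^ 2 = d) (hgen : Algebra.adjoin ℚ {algebraMap (𝓞 F) F δ} = ⊤) (hd8 : d % 8 = 5)
    (hε : Algebra.norm ℚ (algebraMap (𝓞 F) F ε) = 1) (hu : IsUnit ε) :
    ∃ L : Bool → AddSubgroup ℍ[𝓞 F, -1, -ε], IsClassification L not := by
  obtain ⟨ω, -, hω, hrep, huniq⟩ := exists_eq_add_mul_half (k := d / 4) hd hsf hδ hgen (by omega)
  obtain ⟨l, hl⟩ : ∃ l : ℕ, d / 4 = 2 * l + 1 := ⟨d / 8, by omega⟩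
  rw [hl] at hω
  push_cast at hω
  have hprime := two_dvd_or_of_inert (k := l) (by rw [hω]; push_cast; ring) hrep huniq
  have hs : ¬ 2 ∣ ε ^ 2 := fun h => by
    have h1 : (2 : 𝓞 F) ∣ (1 : ℤ) + (0 : ℤ) * ω := by
      simpa using h.trans (hu.pow 2).dvd
    have := ((two_dvd_add_mul_iff hrep huniq).1 h1).1
    omega
  rcases four_dvd_pow_three_sub_or_add hd hsf hδ hgen hd8 hε with ⟨c, hc⟩ | ⟨c, hc⟩
  · exact ⟨_, isClassification_inert two_ne_zero hprime hs (ν := ε ^ 2 * ω)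
      ⟨ε ^ 4 * (l + ω) + ε + 3 * ε * c, by
        linear_combination 3 * ε * hc + 2 * ε ^ 4 * hω⟩⟩
  · exact ⟨_, isClassification_inert two_ne_zero hprime hs (ν := 0)
      ⟨ε * c, by linear_combination ε * hc⟩⟩

lemma exists_isClassification_three_mod_four_of_even (hd : 1 < d) (hsf : Squarefree d)
    (hδ : δ ^ 2 = d) (hgen : Algebra.adjoin ℚ {algebraMap (𝓞 F) F δ} = ⊤)
    (hd4 : d % 4 = 3) (hε : ε = a + b * δ) (hab : a ^ 2 - d * b ^ 2 = 1) (ha : a % 2 = 0) :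
    ∃ L : Bool → AddSubgroup ℍ[𝓞 F, -1, -ε], IsClassification L id := by
  obtain ⟨φ, -, H⟩ := exists_isRamified_three hδ hd4
    (exists_eq_add_mul_sqrt hd hsf hδ hgen (.inr hd4))
    (fun _ _ => eq_zero_of_intCast_add_mul_eq_zero hd hsf hδ)
  obtain ⟨k, rfl⟩ : ∃ k, a = 2 * k := ⟨a / 2, by omega⟩
  obtain ⟨l, rfl | rfl⟩ := Int.even_or_odd' b
  · have : 2 * (2 * k ^ 2 - d * (2 * l ^ 2)) = 1 := by linear_combination hab
    omega
  have hd' : (d : 𝓞 F) + 1 = 4 * ((d + 1) / 4 : ℕ) := by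
    exact_mod_cast congrArg (Nat.cast : ℕ → 𝓞 F) (by omega : d + 1 = 4 * ((d + 1) / 4))
  exact ⟨_, H.isClassification_nonsquare two_ne_zero
    ⟨k - 1 + l * δ, by rw [hε]; push_cast; ring⟩ (w₁ := 1) (w₂ := ((d + 1) / 4 : ℕ)) (by ring)
    (map_one φ) ⟨((d + 1) / 4 : ℕ), by linear_combination hδ + hd'⟩⟩

lemma exists_isClassification_three_mod_four_of_odd (hd : 1 < d) (hsf : Squarefree d)
    (hδ : δ ^ 2 = d) (hgen : Algebra.adjoin ℚ {algebraMap (𝓞 F) F δ} = ⊤)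
    (hd4 : d % 4 = 3) (hε : ε = a + b * δ) (hab : a ^ 2 - d * b ^ 2 = 1) (ha : a % 2 = 1) :
    ∃ L : Fin 4 → AddSubgroup ℍ[𝓞 F, -1, -ε], IsClassification L ![1, 0, 2, 3] := by
  obtain ⟨φ, hφ, H⟩ := exists_isRamified_three hδ hd4
    (exists_eq_add_mul_sqrt hd hsf hδ hgen (.inr hd4))
    (fun _ _ => eq_zero_of_intCast_add_mul_eq_zero hd hsf hδ)
  obtain ⟨c, rfl⟩ := four_dvd_of_sq_sub_mul_sq_eq_one ha (by omega) hab
  have hφ2 : φ 2 = 0 := map_ofNat φ 2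
  have hd' : (d : 𝓞 F) + 1 = 4 * ((d + 1) / 4 : ℕ) := by
    exact_mod_cast congrArg (Nat.cast : ℕ → 𝓞 F) (by omega : d + 1 = 4 * ((d + 1) / 4))
  have hw : 1 + (2 * ((d + 1) / 4 : ℕ) + δ) = (1 + δ) * 1 + 2 * ((d + 1) / 4 : ℕ) := by ring
  have hp : 4 ∣ (1 + δ - 1) ^ 2 + 1 := ⟨((d + 1) / 4 : ℕ), by linear_combination hδ + hd'⟩
  rcases (by omega : a % 4 = 3 ∨ a % 4 = 1) with ha | ha
  · obtain ⟨k, rfl⟩ : ∃ k, a = 4 * k - 1 := ⟨a / 4 + 1, by omega⟩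
    exact ⟨_, H.isClassification_split two_ne_zero (s := 1) (u := 2 * (k + c * δ)) (map_one φ)
      (by simp) (by rw [hε]; push_cast; ring) (by rw [map_mul, hφ2, zero_mul]) hw (map_one φ) hp⟩
  · obtain ⟨k, rfl⟩ : ∃ k, a = 4 * k + 1 := ⟨a / 4, by omega⟩
    exact ⟨_, H.isClassification_split two_ne_zero (s := 2 + δ)
      (u := 2 * (k + c * δ + 1 + δ + ((d + 1) / 4 : ℕ))) (by rw [map_add, hφ2, hφ, zero_add])
      ⟨1 + 2 * δ + 2 * ((d + 1) / 4 : ℕ), by linear_combination hδ + hd'⟩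
      (by rw [hε]; push_cast; linear_combination hδ + hd') (by rw [map_mul, hφ2, zero_mul])
      hw (map_one φ) hp⟩

lemma exists_isClassification_two_mod_four (hd : 1 < d) (hsf : Squarefree d)
    (hδ : δ ^ 2 = d) (hgen : Algebra.adjoin ℚ {algebraMap (𝓞 F) F δ} = ⊤) (hd4 : d % 4 = 2)
    (hnorm : Algebra.norm ℚ (algebraMap (𝓞 F) F ε) = 1) :
    ∃ L : Fin 4 → AddSubgroup ℍ[𝓞 F, -1, -ε], IsClassification L ![1, 0, 2, 3] := by
  obtain ⟨φ, hφ, H⟩ := exists_isRamified_two hδ hd4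
    (exists_eq_add_mul_sqrt hd hsf hδ hgen (.inl hd4))
    (fun _ _ => eq_zero_of_intCast_add_mul_eq_zero hd hsf hδ)
  obtain ⟨a, b, hε⟩ := exists_eq_add_mul_sqrt hd hsf hδ hgen (.inl hd4) ε
  have hab := sq_sub_mul_sq_eq hd hsf hδ hgen hnorm (l := 1) (m := a) (n := b) (by simpa using hε)
  have hφ2 : φ 2 = 0 := map_ofNat φ 2
  obtain ⟨q, hq⟩ : ∃ q, d = 4 * q + 2 := ⟨d / 4, by omega⟩
  have hw : 1 + ((d / 2 : ℕ) : 𝓞 F) = δ * 0 + 2 * (q + 1) := by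
    rw [show d / 2 = 2 * q + 1 by omega]
    push_cast
    ring
  have hdq : (d : 𝓞 F) = 4 * q + 2 := by rw [hq]; push_cast; ring
  have hb : Even b ∧ a % 2 = 1 := by
    have hdq : (d : ℤ) = 4 * q + 2 := by omega
    rw [hdq] at hab
    obtain ⟨k, rfl | rfl⟩ := Int.even_or_odd' a
    · have : 2 * (2 * k ^ 2 - (2 * q + 1) * b ^ 2) = 1 := by linear_combination hab
      omega
    · refine ⟨?_, by omega⟩
      have : Even ((2 * q + 1 : ℤ) * b ^ 2) := ⟨k * (k + 1), by linarith⟩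
      refine (Int.even_pow.1 ((Int.even_mul.1 this).resolve_left ?_)).1
      rw [Int.even_iff]
      omega
  obtain ⟨⟨c, rfl⟩, ha⟩ := hb
  rcases (by omega : a % 4 = 3 ∨ a % 4 = 1) with ha | ha
  · obtain ⟨k, rfl⟩ : ∃ k, a = 4 * k - 1 := ⟨a / 4 + 1, by omega⟩
    exact ⟨_, H.isClassification_cross two_ne_zero (s := 1) (u := 2 * k + c * δ) (map_one φ)
      (by simp) (by rw [hε]; push_cast; ring)
      (by rw [map_add, map_mul, map_mul, hφ2, hφ, zero_mul, mul_zero, add_zero]) hw (map_zero φ)⟩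
  · obtain ⟨k, rfl⟩ : ∃ k, a = 4 * k + 1 := ⟨a / 4, by omega⟩
    exact ⟨_, H.isClassification_cross two_ne_zero (s := 1 + δ)
      (u := 2 * (k + q + 1) + (c + 1) * δ) (by rw [map_add, map_one, hφ, add_zero])
      ⟨δ + 2 * q + 1, by linear_combination hδ + hdq⟩
      (by rw [hε]; push_cast; linear_combination hδ + hdq)
      (by rw [map_add, map_mul, map_mul, hφ2, hφ, zero_mul, mul_zero, add_zero]) hw (map_zero φ)⟩

end QuadraticField

/-- **`ℵ(𝒪₂‡)` and `ℶ(𝒪₂‡)` for the order `𝒪₂‡ = O_F[i,j] ⊂ (−1,−ε / F)`** -/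
theorem aleph_beth_O2
    (d : ℕ) (hd6 : 6 ≤ d) (hdsf : Squarefree d)
    (sqrtd : F) (hsqrtd : sqrtd ^ 2 = (d : F))
    (hgen : Algebra.adjoin ℚ {sqrtd} = ⊤)
    (σ₀ : F →+* ℝ) (hσ₀ : 0 < σ₀ sqrtd)
    -- `ε` is the fundamental unit of `F`: the smallest unit greater than `1`
    (ε : (𝓞 F)ˣ) (hε : 1 < σ₀ (algebraMap (𝓞 F) F ↑ε))
    (hεfund : ∀ u : (𝓞 F)ˣ, 1 < σ₀ (algebraMap (𝓞 F) F ↑u) →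
      σ₀ (algebraMap (𝓞 F) F ↑ε) ≤ σ₀ (algebraMap (𝓞 F) F ↑u))
    (hnorm : Algebra.norm ℚ (algebraMap (𝓞 F) F ↑ε) = 1) :
    -- `𝒪₂‡ = O_F[i, j] ⊆ H = (−1, −ε / F)`
    let 𝒪 : Subring ℍ[F, -1, -(algebraMap (𝓞 F) F ↑ε)] :=
      Subring.closure
        (scalarSet F ℍ[F, -1, -(algebraMap (𝓞 F) F ↑ε)] ∪ {⟨0, 1, 0, 0⟩, ⟨0, 0, 1, 0⟩})
    -- case `d ≡ 1 (mod 8)`, `a ≡ 1 (mod 4)` (whenever `ε = a + b√d ∈ ℤ[√d]`)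
    (∀ a b : ℕ, algebraMap (𝓞 F) F ↑ε = (a : F) + (b : F) * sqrtd →
      d % 8 = 1 → a % 4 = 1 → alephNum F 𝒪 = 1 ∧ bethNum F 𝒪 = 1) ∧
    -- case `d ≡ 1 (mod 8)`, `a ≡ 3 (mod 4)`
    (∀ a b : ℕ, algebraMap (𝓞 F) F ↑ε = (a : F) + (b : F) * sqrtd →
      d % 8 = 1 → a % 4 = 3 → alephNum F 𝒪 = 4 ∧ bethNum F 𝒪 = 2) ∧
    -- case `d ≡ 5 (mod 8)`
    (d % 8 = 5 → alephNum F 𝒪 = 2 ∧ bethNum F 𝒪 = 1) ∧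
    -- case `d ≡ 3 (mod 4)`, `a` even
    (∀ a b : ℕ, algebraMap (𝓞 F) F ↑ε = (a : F) + (b : F) * sqrtd →
      d % 4 = 3 → a % 2 = 0 → alephNum F 𝒪 = 2 ∧ bethNum F 𝒪 = 2) ∧
    -- remaining case: `d ≡ 2 (mod 4)`
    (d % 4 = 2 → alephNum F 𝒪 = 4 ∧ bethNum F 𝒪 = 3) ∧
    -- remaining case: `d ≡ 3 (mod 4)`, `a` odd
    (∀ a b : ℕ, algebraMap (𝓞 F) F ↑ε = (a : F) + (b : F) * sqrtd →
      d % 4 = 3 → a % 2 = 1 → alephNum F 𝒪 = 4 ∧ bethNum F 𝒪 = 3) := by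
  intro 𝒪
  have h𝒪 : 𝒪 = (intEmbedding (ε : 𝓞 F)).range := closure_eq_range
  rw [h𝒪]
  clear_value 𝒪
  have h_int : IsIntegral ℤ sqrtd := .of_pow two_pos <| by
    rw [hsqrtd]
    exact isIntegral_natCast d
  obtain ⟨δ, rfl⟩ : ∃ δ : 𝓞 F, algebraMap (𝓞 F) F δ = sqrtd := ⟨⟨sqrtd, h_int⟩, rfl⟩
  have hinj := RingOfIntegers.coe_injective (K := F)
  have hδ : δ ^ 2 = d := hinj (by simpa using hsqrtd)
  have hd : 1 < d := by omega
  have hcoord : ∀ a b : ℕ,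
      algebraMap (𝓞 F) F ε = (a : F) + (b : F) * algebraMap (𝓞 F) F δ →
      (ε : 𝓞 F) = ((a : ℤ) : 𝓞 F) + ((b : ℤ) : 𝓞 F) * δ ∧ (a : ℤ) ^ 2 - d * (b : ℤ) ^ 2 = 1 := by
    intro a b h
    have h1 : (ε : 𝓞 F) = ((a : ℤ) : 𝓞 F) + ((b : ℤ) : 𝓞 F) * δ := hinj (by simpa using h)
    exact ⟨h1, by simpa using sq_sub_mul_sq_eq hd hdsf hδ hgen hnorm (l := 1) (by simpa using h1)⟩
  have key {ι κ : Type} {L : ι → AddSubgroup ℍ[𝓞 F, -1, -(ε : 𝓞 F)]} {τ : ι → ι}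
      (hL : IsClassification L τ) (f : ι → κ) (hf : Function.Surjective f)
      (hfτ : ∀ s t, f s = f t ↔ s = t ∨ t = τ s) :=
    alephNum_bethNum_eq hL (sq_ne_neg_one σ₀)
      (fun _ _ _ => sq_add_mul_eq_one hd hdsf hδ hgen hε hεfund hnorm)
      (fun _ _ => sq_add_sq_eq_one hd hdsf hδ hgen σ₀) hf hfτ
  have hcross : Function.Surjective ![0, 0, 1, (2 : Fin 3)] ∧
      ∀ s t : Fin 4, ![0, 0, 1, (2 : Fin 3)] s = ![0, 0, 1, 2] t ↔
        s = t ∨ t = ![1, 0, 2, 3] s := by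
    decide
  refine ⟨fun a b h h8 ha => ?_, fun a b h h8 ha => ?_, fun h8 => ?_, fun a b h h4 ha => ?_,
    fun h4 => ?_, fun a b h h4 ha => ?_⟩
  · obtain ⟨h1, h2⟩ := hcoord a b h
    obtain ⟨L, hL⟩ := exists_isClassification_one_mod_eight_of_one hd hdsf hδ hgen h8 h1 h2
      (by omega)
    simpa using key hL id Function.surjective_id (by simp)
  · obtain ⟨h1, h2⟩ := hcoord a b h
    obtain ⟨L, hL⟩ := exists_isClassification_one_mod_eight_of_three hd hdsf hδ hgen h8 h1 h2
      (by omega)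
    simpa using key hL Prod.fst Prod.fst_surjective (by decide)
  · obtain ⟨L, hL⟩ := exists_isClassification_five_mod_eight hd hdsf hδ hgen h8 hnorm ε.isUnit
    simpa using key hL (fun _ => ()) (by decide) (by decide)
  · obtain ⟨h1, h2⟩ := hcoord a b h
    obtain ⟨L, hL⟩ := exists_isClassification_three_mod_four_of_even hd hdsf hδ hgen h4 h1 h2
      (by omega)
    simpa using key hL id Function.surjective_id (by decide)
  · obtain ⟨L, hL⟩ := exists_isClassification_two_mod_four hd hdsf hδ hgen h4 hnorm
    simpa using key hL _ hcross.1 hcross.2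
  · obtain ⟨h1, h2⟩ := hcoord a b h
    obtain ⟨L, hL⟩ := exists_isClassification_three_mod_four_of_odd hd hdsf hδ hgen h4 h1 h2
      (by omega)
    simpa using key hL _ hcross.1 hcross.2

end QuatPaper
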